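/- arXiv:2106.14818 — 6 statements merged into one kernel-verified Lean document; each statement's English description precedes it below -/
import Mathlib

section
/- Let (A_n)_{n≥1} be a decreasing sequence of subsets of [1,2], each a finite union of closed intervals with positive Lebesgue measure |A_n|, let ν_n = |A_n|^{−1} 1_{A_n} and σ_n = ν_{n+1} − ν_n, and suppose the measures ν_n(x)dx converge in the weak* sense to a Borel probability measure ν. Let d ≥ 2 be an even integer and suppose there are constants θ, ξ, K > 0 such that for every k ≥ 1, every measurable function r: ℝ → [1,2] and every bounded measurable set Ω ⊂ [0,1]: (i) ∫_{Ω^d} ∫_ℝ ∏_{j=1}^d σ_k((z−x_j)/r(x_j)) dz dx ≤ K e^{−θk} |Ω|^{d−1}, and (ii) ∫_{Ω^{d+2}} ∫_ℝ ∏_{j=1}^{d+2} σ_k((z−x_j)/r(x_j)) dz dx ≤ K e^{ξk} |Ω|^{d+1}. Then, with p_0 = ((2+d)θ + dξ)/((1+d)θ + (d−1)ξ), the restricted maximal operator M_ν is bounded from L^p(ℝ) to L^q(ℝ) for every p > p_0 and every q with p ≤ q ≤ p/(p_0 − 1). -/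
open MeasureTheory Set Filter

/-- The restricted maximal operator `M_ν f(x) = sup_{r ∈ [1,2]} ∫ |f(x+ry)| dν(y)`. -/
noncomputable def restrictedMax (ν : Measure ℝ) (f : ℝ → ℝ) (x : ℝ) : ℝ :=
  ⨆ r : Icc (1 : ℝ) 2, ∫ y, |f (x + (r : ℝ) * y)| ∂ν

/-- Balancing decay and growth: the sum of the minima is controlled by the geometric mean. -/
lemma sum_min_exp_le {a b : ℝ} (ha : 0 < a) (hb : 0 < b) :
    ∃ C : ℝ, 0 ≤ C ∧ ∀ X Y : ℝ, 0 < X → 0 < Y → ∀ s : Finset ℕ,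
      ∑ k ∈ s, min (Real.exp (-a * k) * X) (Real.exp (b * k) * Y) ≤
        C * (X ^ (b / (a + b)) * Y ^ (a / (a + b))) := by
  set c := min a b with hc
  have hcpos : 0 < c := lt_min ha hb
  have hsum : Summable fun j : ℤ => Real.exp (-c * |(j : ℝ)|) := by
    have h0 : Summable fun j : ℕ => Real.exp (-c * |((j : ℤ) : ℝ)|) := by
      have := Real.summable_exp_nat_mul_iff.2 (neg_lt_zero.2 hcpos)
      refine this.congr fun j => ?_
      simp [mul_comm]
    refine Summable.of_nat_of_neg h0 ?_
    simpa using h0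
  refine ⟨Real.exp c * ∑' j : ℤ, Real.exp (-c * |(j : ℝ)|),
    mul_nonneg (Real.exp_pos _).le (tsum_nonneg fun _ => (Real.exp_pos _).le), ?_⟩
  intro X Y hX hY s
  have hab : 0 < a + b := by positivity
  set t := (Real.log X - Real.log Y) / (a + b) with ht
  have hm : X ^ (b / (a + b)) * Y ^ (a / (a + b)) =
      Real.exp ((b * Real.log X + a * Real.log Y) / (a + b)) := by
    rw [Real.rpow_def_of_pos hX, Real.rpow_def_of_pos hY, ← Real.exp_add]
    congr 1; field_simp
  rw [hm]
  set G := (b * Real.log X + a * Real.log Y) / (a + b) with hG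
  have hXt : Real.log X = G + a * t := by rw [hG, ht]; field_simp; ring
  have hYt : Real.log Y = G - b * t := by rw [hG, ht]; field_simp; ring
  have key : ∀ k : ℕ, min (Real.exp (-a * k) * X) (Real.exp (b * k) * Y) ≤
      Real.exp c * Real.exp G * Real.exp (-c * |(((k : ℤ) - ⌊t⌋ : ℤ) : ℝ)|) := by
    intro k
    rw [← Real.exp_log hX, ← Real.exp_log hY, ← Real.exp_add, ← Real.exp_add, ← Real.exp_add,
      ← Real.exp_add, hXt, hYt]
    have hf := Int.floor_le t
    have hf' := (Int.lt_floor_add_one t).le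
    have hca : c ≤ a := min_le_left _ _
    have hcb : c ≤ b := min_le_right _ _
    push_cast
    rcases le_total ((k : ℝ)) t with h | h
    · refine (min_le_right _ _).trans (Real.exp_le_exp.2 ?_)
      have : |(k : ℝ) - ⌊t⌋| ≤ t - k + 1 := abs_le.2 ⟨by linarith, by linarith⟩
      nlinarith
    · refine (min_le_left _ _).trans (Real.exp_le_exp.2 ?_)
      have : |(k : ℝ) - ⌊t⌋| ≤ k - t + 1 := abs_le.2 ⟨by linarith, by linarith⟩
      nlinarith
  calc _ ≤ ∑ k ∈ s, Real.exp c * Real.exp G * Real.exp (-c * |(((k : ℤ) - ⌊t⌋ : ℤ) : ℝ)|) :=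
        Finset.sum_le_sum fun k _ => key k
    _ = Real.exp c * Real.exp G * ∑ k ∈ s, Real.exp (-c * |(((k : ℤ) - ⌊t⌋ : ℤ) : ℝ)|) := by
        rw [Finset.mul_sum]
    _ ≤ Real.exp c * Real.exp G * ∑' j : ℤ, Real.exp (-c * |(j : ℝ)|) := by
        gcongr
        have hinj : Function.Injective fun k : ℕ => (k : ℤ) - ⌊t⌋ := fun i j h => by
          simpa using h
        rw [← Finset.sum_image (s := s) (g := fun k : ℕ => (k : ℤ) - ⌊t⌋)
          (f := fun j : ℤ => Real.exp (-c * |(j : ℝ)|)) hinj.injOn]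
        exact hsum.sum_le_tsum _ fun _ _ => (Real.exp_pos _).le
    _ = _ := by ring

lemma measurable_dilated {s r : ℝ → ℝ} (hs : Measurable s) (hr : Measurable r) :
    Measurable fun w : ℝ × ℝ => s ((w.2 - w.1) / r w.1) :=
  hs.comp ((measurable_snd.sub measurable_fst).div (hr.comp measurable_fst))

/-- Expanding an even power of a dilated average as a multiple integral and applying Hölder. -/
lemma setIntegral_dilated_le {s r : ℝ → ℝ} {B : ℝ} (hs : Measurable s) (hB : ∀ t, |s t| ≤ B)
    (hs0 : ∀ t, t ∉ Icc (1 : ℝ) 2 → s t = 0) (hr : Measurable r)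
    (hr12 : ∀ t, r t ∈ Icc (1 : ℝ) 2) {D : ℕ} (hD : 2 ≤ D) (hDe : Even D) {L : ℝ}
    {Ω : Set ℝ} (hΩ : MeasurableSet Ω) (hΩ1 : Ω ⊆ Icc 0 1)
    (hL : (∫ x : Fin D → ℝ in univ.pi fun _ => Ω,
        ∫ z : ℝ, ∏ j, s ((z - x j) / r (x j))) ≤ L)
    {E : Set ℝ} (hEf : volume E ≠ ⊤) :
    (∫ z in E, ∫ x in Ω, s ((z - x) / r x)) ≤
      (volume E).toReal ^ (1 - 1 / (D : ℝ)) * L ^ (1 / (D : ℝ)) := by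
  have hΩfin : volume Ω < ⊤ := (measure_mono hΩ1).trans_lt (by simp)
  have : IsFiniteMeasure (volume.restrict Ω) := ⟨by simpa using hΩfin⟩
  have : IsFiniteMeasure (volume.restrict E) := ⟨by simpa using hEf.lt_top⟩
  have hD0 : 0 < D := by omega
  have hB0 : 0 ≤ B := (abs_nonneg _).trans (hB 0)
  set μ := volume.restrict Ω with hμ
  set G : ℝ → ℝ := fun z => ∫ x, s ((z - x) / r x) ∂μ with hG
  have hsm := measurable_dilated hs hr
  have hGm : Measurable G :=
    (hsm.stronglyMeasurable.integral_prod_left' (μ := μ)).measurable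
  have hGb : ∀ z, ‖G z‖ ≤ B * μ.real univ := fun z =>
    norm_integral_le_of_norm_le_const (Eventually.of_forall fun x => hB _)
  have hprod : ∀ z, ∫ x : Fin D → ℝ, ∏ j, s ((z - x j) / r (x j)) ∂(Measure.pi fun _ => μ) =
      G z ^ D := fun z => by
    have := integral_fintype_prod_eq_pow (ι := Fin D) (μ := μ) (fun x => s ((z - x) / r x))
    simpa only [Fintype.card_fin] using this
  have hjoint : Integrable (Function.uncurry fun (x : Fin D → ℝ) (z : ℝ) =>
      ∏ j, s ((z - x j) / r (x j))) ((Measure.pi fun _ : Fin D => μ).prod volume) := by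
    have hdom : Integrable (fun w : (Fin D → ℝ) × ℝ =>
        B ^ D * (Icc (1 : ℝ) 5).indicator 1 w.2)
        ((Measure.pi fun _ : Fin D => volume.restrict Ω).prod volume) := by
      refine Integrable.const_mul ?_ _
      refine Integrable.comp_snd (f := (Icc (1 : ℝ) 5).indicator (1 : ℝ → ℝ)) ?_ _
      rw [integrable_indicator_iff measurableSet_Icc]
      exact integrableOn_const (by simp)
    refine hdom.mono' ?_ ?_
    · refine Measurable.aestronglyMeasurable ?_
      refine Finset.measurable_prod _ fun j _ => ?_
      exact hsm.comp (f := fun w : (Fin D → ℝ) × ℝ => (w.1 j, w.2))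
        (((measurable_pi_apply j).comp measurable_fst).prodMk measurable_snd)
    · have hae : ∀ᵐ x ∂(Measure.pi fun _ : Fin D => volume.restrict Ω),
          x ∈ (univ.pi fun _ : Fin D => Ω) := by
        rw [← Measure.restrict_pi_pi]
        exact ae_restrict_mem (MeasurableSet.univ_pi fun _ => hΩ)
      have hae' : ∀ᵐ w : (Fin D → ℝ) × ℝ
          ∂((Measure.pi fun _ : Fin D => volume.restrict Ω).prod volume),
          w.1 ∈ (univ.pi fun _ : Fin D => Ω) :=
        Measure.quasiMeasurePreserving_fst.ae hae
      filter_upwards [hae'] with w hw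
      simp only [Function.uncurry, norm_prod, Real.norm_eq_abs]
      by_cases hz : w.2 ∈ Icc (1 : ℝ) 5
      · simp only [indicator_of_mem hz, Pi.one_apply, mul_one]
        refine (Finset.prod_le_prod (fun _ _ => abs_nonneg _) fun j _ => hB _).trans ?_
        simp
      · simp only [indicator_of_notMem hz, mul_zero]
        refine le_of_eq (Finset.prod_eq_zero (Finset.mem_univ (⟨0, hD0⟩ : Fin D)) ?_)
        rw [hs0, abs_zero]
        intro h
        apply hz
        have h1 := hΩ1 (hw ⟨0, hD0⟩ (mem_univ _))
        have h2 := hr12 (w.1 ⟨0, hD0⟩)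
        have h3 : 0 < r (w.1 ⟨0, hD0⟩) := by linarith [h2.1]
        rw [mem_Icc, le_div_iff₀ h3, div_le_iff₀ h3] at h
        exact ⟨by linarith [h.1, h1.1, h2.1], by linarith [h.2, h1.2, h2.2]⟩
  have hpow : ∫ z, G z ^ D ≤ L := by
    refine le_trans (le_of_eq ?_) hL
    rw [volume_pi, Measure.restrict_pi_pi, integral_integral_swap hjoint]
    exact integral_congr_ae (Eventually.of_forall fun z => (hprod z).symm)
  have hGD : ∀ z, |G z| ^ (D : ℝ) = G z ^ D := fun z => by
    rw [Real.rpow_natCast, hDe.pow_abs]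
  have hInt : Integrable (fun z => G z ^ D) := by
    simpa only [Function.uncurry, hprod] using hjoint.integral_prod_right
  have hD1 : (1 : ℝ) < D := by exact_mod_cast hD
  have hconj : (1 - 1 / (D : ℝ))⁻¹.HolderConjugate D := by
    rw [Real.holderConjugate_iff]
    refine ⟨(one_lt_inv₀ ?_).2 ?_, by rw [inv_inv, one_div]; ring⟩
    · rw [sub_pos, div_lt_one (by linarith)]; exact hD1
    · have : 0 < 1 / (D : ℝ) := by positivity
      linarith
  have hol := integral_mul_le_Lp_mul_Lq_of_nonneg (μ := volume.restrict E) hconj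
    (f := fun _ => 1) (g := fun z => |G z|) (Eventually.of_forall fun _ => zero_le_one)
    (Eventually.of_forall fun _ => abs_nonneg _) (memLp_const _)
    (MemLp.of_bound (C := B * μ.real univ) hGm.abs.aestronglyMeasurable
      (Eventually.of_forall fun z => by simpa using hGb z))
  have hL0 : 0 ≤ ∫ z in E, |G z| ^ (D : ℝ) :=
    integral_nonneg fun z => Real.rpow_nonneg (abs_nonneg _) _
  have hLE : ∫ z in E, |G z| ^ (D : ℝ) ≤ L := by
    simp only [hGD]
    exact (setIntegral_le_integral hInt (Eventually.of_forall fun z => hDe.pow_nonneg _)).trans hpow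
  have hGi : Integrable G (volume.restrict E) :=
    Integrable.of_bound hGm.aestronglyMeasurable _ (Eventually.of_forall hGb)
  calc (∫ z in E, G z) ≤ ∫ z in E, 1 * |G z| := by
        simp only [one_mul]
        exact integral_mono hGi hGi.abs fun z => le_abs_self _
    _ ≤ _ := hol
    _ ≤ _ := by
        simp only [Real.one_rpow, integral_const, smul_eq_mul, mul_one, one_div, inv_inv,
          Measure.real, Measure.restrict_apply_univ]
        gcongr

/-- The restricted-type bilinear estimate obtained by balancing the decaying bound in `L^d`
against the growing bound in `L^(d+2)`. -/
lemma exists_restricted_bound {N σ : ℕ → ℝ → ℝ} {B : ℕ → ℝ} (hNm : ∀ n, Measurable (N n))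
    (hNB : ∀ n t, |N n t| ≤ B n) (hN0 : ∀ n t, t ∉ Icc (1 : ℝ) 2 → N n t = 0)
    (hσ : ∀ n t, σ n t = N (n + 1) t - N n t)
    {d : ℕ} (hd2 : 2 ≤ d) (hdeven : Even d) {θ ξ K : ℝ} (hθ : 0 < θ) (hξ : 0 < ξ) (hK : 0 < K)
    (h1 : ∀ k : ℕ, 1 ≤ k → ∀ r : ℝ → ℝ, Measurable r → (∀ t, r t ∈ Icc (1 : ℝ) 2) →
      ∀ Ω : Set ℝ, MeasurableSet Ω → Ω ⊆ Icc 0 1 →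
      (∫ x : Fin d → ℝ in univ.pi fun _ => Ω,
        ∫ z : ℝ, ∏ j, σ k ((z - x j) / r (x j))) ≤
        K * Real.exp (-θ * k) * (volume Ω).toReal ^ (d - 1))
    (h2 : ∀ k : ℕ, 1 ≤ k → ∀ r : ℝ → ℝ, Measurable r → (∀ t, r t ∈ Icc (1 : ℝ) 2) →
      ∀ Ω : Set ℝ, MeasurableSet Ω → Ω ⊆ Icc 0 1 →
      (∫ x : Fin (d + 2) → ℝ in univ.pi fun _ => Ω,
        ∫ z : ℝ, ∏ j, σ k ((z - x j) / r (x j))) ≤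
        K * Real.exp (ξ * k) * (volume Ω).toReal ^ (d + 1))
    {γ : ℝ} (hγ : γ * ((2 + (d : ℝ)) * θ + (d : ℝ) * ξ) = (1 + (d : ℝ)) * θ + ((d : ℝ) - 1) * ξ) :
    ∃ C : ℝ, 0 ≤ C ∧ ∀ (n : ℕ) (r : ℝ → ℝ), Measurable r → (∀ t, r t ∈ Icc (1 : ℝ) 2) →
      ∀ Ω E : Set ℝ, MeasurableSet Ω → Ω ⊆ Icc 0 1 → MeasurableSet E → E ⊆ Icc 1 5 →
        (∫ z in E, ∫ x in Ω, N (n + 1) ((z - x) / r x)) ≤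
          C * ((volume E).toReal * (volume Ω).toReal) ^ γ := by
  have hdR : (2 : ℝ) ≤ d := by exact_mod_cast hd2
  set a := θ / d with ha
  set b := ξ / (d + 2) with hb
  have hapos : 0 < a := by positivity
  have hbpos : 0 < b := by positivity
  obtain ⟨C, hC0, hC⟩ := sum_min_exp_le hapos hbpos
  set u := b / (a + b) with hu
  set v := a / (a + b) with hv
  have huv : (1 - 1 / (d : ℝ)) * u + (1 - 1 / ((d : ℝ) + 2)) * v = γ := by
    have : (2 + (d : ℝ)) * θ + (d : ℝ) * ξ ≠ 0 := by positivity
    rw [← mul_left_inj' this, hγ, hu, hv, ha, hb]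
    field_simp
    ring
  have hγ1 : γ ≤ 1 := by
    by_contra! h
    nlinarith [mul_lt_mul_of_pos_right h (show 0 < (2 + (d : ℝ)) * θ + (d : ℝ) * ξ by positivity)]
  have hB0 : 0 ≤ B 1 := (abs_nonneg _).trans (hNB 1 0)
  set C' := C * ((K ^ (1 / (d : ℝ))) ^ u * (K ^ (1 / ((d : ℝ) + 2))) ^ v) with hC'
  refine ⟨B 1 * 4 ^ (1 - γ) + C', by positivity, ?_⟩
  intro n r hr hr12 Ω E hΩ hΩ1 hE hE5
  have hΩle : volume Ω ≤ 1 := (measure_mono hΩ1).trans (by simp)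
  have hEle : volume E ≤ 4 := (measure_mono hE5).trans (by rw [Real.volume_Icc]; norm_num)
  have hΩfin : volume Ω < ⊤ := hΩle.trans_lt (by simp)
  have hEfin : volume E < ⊤ := hEle.trans_lt (by simp)
  have : IsFiniteMeasure (volume.restrict Ω) := ⟨by simpa using hΩfin⟩
  have : IsFiniteMeasure (volume.restrict E) := ⟨by simpa using hEfin⟩
  rcases eq_or_ne (volume E) 0 with hE0 | hE0
  · rw [Measure.restrict_eq_zero.2 hE0, integral_zero_measure]
    positivity
  rcases eq_or_ne (volume Ω) 0 with hΩ0 | hΩ0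
  · simp only [Measure.restrict_eq_zero.2 hΩ0, integral_zero_measure, integral_zero]
    positivity
  set e := (volume E).toReal with he
  set o := (volume Ω).toReal with ho
  have hepos : 0 < e := ENNReal.toReal_pos hE0 hEfin.ne
  have hopos : 0 < o := ENNReal.toReal_pos hΩ0 hΩfin.ne
  have he4 : e ≤ 4 := by simpa using ENNReal.toReal_mono (by simp) hEle
  have ho1 : o ≤ 1 := by simpa using ENNReal.toReal_mono (by simp) hΩle
  set w := e * o with hw
  have hwpos : 0 < w := by positivity
  have hw4 : w ≤ 4 := by nlinarith
  have hbd : ∀ k : ℕ, 1 ≤ k → (∫ z in E, ∫ x in Ω, σ k ((z - x) / r x)) ≤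
      min (Real.exp (-a * k) * (K ^ (1 / (d : ℝ)) * w ^ (1 - 1 / (d : ℝ))))
        (Real.exp (b * k) * (K ^ (1 / ((d : ℝ) + 2)) * w ^ (1 - 1 / ((d : ℝ) + 2)))) := by
    intro k hk
    have hσm : Measurable (σ k) := by
      rw [show σ k = fun t => N (k + 1) t - N k t from funext (hσ k)]
      exact (hNm _).sub (hNm _)
    have hσB : ∀ t, |σ k t| ≤ B (k + 1) + B k := fun t => by
      rw [hσ]
      exact (abs_sub _ _).trans (add_le_add (hNB _ _) (hNB _ _))
    have hσ0 : ∀ t, t ∉ Icc (1 : ℝ) 2 → σ k t = 0 := fun t ht => by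
      rw [hσ, hN0 _ _ ht, hN0 _ _ ht, sub_zero]
    refine le_min ?_ ?_
    · refine (setIntegral_dilated_le hσm hσB hσ0 hr hr12 hd2 hdeven hΩ hΩ1
        (h1 k hk r hr hr12 Ω hΩ hΩ1) hEfin.ne).trans (le_of_eq ?_)
      rw [Real.mul_rpow (by positivity) (by positivity), Real.mul_rpow hK.le (by positivity),
        ← Real.exp_mul, ← Real.rpow_natCast, ← Real.rpow_mul (by positivity),
        Real.mul_rpow (by positivity) (by positivity), Nat.cast_sub (by omega)]
      have e1 : -θ * (k : ℝ) * (1 / d) = -a * k := by rw [ha]; ring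
      have e2 : ((d : ℝ) - (1 : ℕ)) * (1 / d) = 1 - 1 / d := by field_simp; simp
      rw [e1, e2]
      ring
    · have := setIntegral_dilated_le hσm hσB hσ0 hr hr12 (D := d + 2) (by omega)
        (hdeven.add even_two) hΩ hΩ1 (h2 k hk r hr hr12 Ω hΩ hΩ1) hEfin.ne
      refine this.trans (le_of_eq ?_)
      rw [Real.mul_rpow (by positivity) (by positivity), Real.mul_rpow hK.le (by positivity),
        ← Real.exp_mul, ← Real.rpow_natCast, ← Real.rpow_mul (by positivity),
        Real.mul_rpow (by positivity) (by positivity)]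
      push_cast
      have e1 : ξ * (k : ℝ) * (1 / (d + 2)) = b * k := by rw [hb]; ring
      have e2 : ((d : ℝ) + 1) * (1 / (d + 2)) = 1 - 1 / (d + 2) := by field_simp; ring
      rw [e1, e2]
      ring
  have hInt : ∀ m : ℕ, Integrable (fun z => ∫ x in Ω, N m ((z - x) / r x))
      (volume.restrict E) := fun m => by
    have : Integrable (fun q : ℝ × ℝ => N m ((q.2 - q.1) / r q.1))
        ((volume.restrict Ω).prod (volume.restrict E)) :=
      Integrable.of_bound (measurable_dilated (hNm m) hr).aestronglyMeasurable (B m)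
        (Eventually.of_forall fun q => hNB _ _)
    exact this.integral_prod_right
  have hInt' : ∀ (m : ℕ) (z : ℝ), Integrable (fun x => N m ((z - x) / r x))
      (volume.restrict Ω) := fun m z =>
    Integrable.of_bound ((measurable_dilated (hNm m) hr).comp
      (measurable_id.prodMk measurable_const)).aestronglyMeasurable (B m)
      (Eventually.of_forall fun q => hNB _ _)
  have htel : (∫ z in E, ∫ x in Ω, N (n + 1) ((z - x) / r x)) =
      (∫ z in E, ∫ x in Ω, N 1 ((z - x) / r x)) +
        ∑ k ∈ Finset.Ico 1 (n + 1), ∫ z in E, ∫ x in Ω, σ k ((z - x) / r x) := by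
    have hstep : ∀ k, (∫ z in E, ∫ x in Ω, σ k ((z - x) / r x)) =
        (∫ z in E, ∫ x in Ω, N (k + 1) ((z - x) / r x)) -
          ∫ z in E, ∫ x in Ω, N k ((z - x) / r x) := fun k => by
      rw [← integral_sub (hInt _) (hInt _)]
      refine integral_congr_ae (Eventually.of_forall fun z => ?_)
      simp only [hσ]
      exact integral_sub (hInt' _ z) (hInt' _ z)
    simp only [hstep]
    rw [Finset.sum_Ico_sub (fun k => ∫ z in E, ∫ x in Ω, N k ((z - x) / r x)) (by omega)]
    ring
  have hfirst : (∫ z in E, ∫ x in Ω, N 1 ((z - x) / r x)) ≤ B 1 * 4 ^ (1 - γ) * w ^ γ := by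
    have hbase : (∫ z in E, ∫ x in Ω, N 1 ((z - x) / r x)) ≤ B 1 * w := by
      have h := norm_integral_le_of_norm_le_const (μ := volume.restrict E)
        (f := fun z => ∫ x in Ω, N 1 ((z - x) / r x)) (C := B 1 * o)
        (Eventually.of_forall fun z => by
          have := norm_integral_le_of_norm_le_const (μ := volume.restrict Ω)
            (f := fun x => N 1 ((z - x) / r x)) (C := B 1) (Eventually.of_forall fun x => hNB _ _)
          simpa [Measure.real] using this)
      refine (le_abs_self _).trans (h.trans (le_of_eq ?_))
      simp only [Measure.real, Measure.restrict_apply_univ]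
      ring
    refine hbase.trans ?_
    rw [mul_assoc]
    gcongr
    calc w = w ^ (1 - γ) * w ^ γ := by rw [← Real.rpow_add hwpos]; simp
      _ ≤ 4 ^ (1 - γ) * w ^ γ := by
        gcongr
  rw [htel, add_mul]
  refine add_le_add hfirst ?_
  refine (Finset.sum_le_sum fun k hk => hbd k (Finset.mem_Ico.1 hk).1).trans ?_
  clear_value w
  refine (hC _ _ (by positivity) (by positivity) _).trans (le_of_eq ?_)
  rw [Real.mul_rpow (by positivity) (by positivity), Real.mul_rpow (by positivity) (by positivity),
    ← Real.rpow_mul hwpos.le, ← Real.rpow_mul hwpos.le, hC', ← huv, Real.rpow_add hwpos]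
  ring

open scoped ENNReal NNReal in
lemma coe_le_one_add_tsum_indicator {β : Type*} (f : β → ℝ≥0) (z : β) :
    (f z : ℝ≥0∞) ≤ 1 + ∑' j : ℕ, (2 : ℝ≥0∞) ^ (j + 1) * {z | 2 ^ j < f z}.indicator 1 z := by
  rcases le_or_gt (f z) 1 with h | h
  · exact le_add_right (by exact_mod_cast h)
  have hex : ∃ j : ℕ, f z ≤ 2 ^ (j + 1) :=
    ((pow_unbounded_of_one_lt (f z) one_lt_two).imp fun j hj =>
      hj.le.trans (pow_le_pow_right₀ one_le_two j.le_succ))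
  have hj2 : f z ≤ 2 ^ (Nat.find hex + 1) := Nat.find_spec hex
  have hj1 : 2 ^ Nat.find hex < f z := by
    rcases hcase : Nat.find hex with _ | i
    · simpa using h
    · exact not_le.1 (Nat.find_min hex (m := i) (by omega))
  refine le_add_left (le_trans ?_ (ENNReal.le_tsum (Nat.find hex)))
  rw [indicator_of_mem (by exact hj1), Pi.one_apply, mul_one]
  exact_mod_cast hj2

open scoped ENNReal NNReal in
/-- An `L^∞` bound together with a restricted bilinear bound gives distributional control. -/
lemma measure_lt_le_of_restricted {α β : Type*} [MeasurableSpace α] [MeasurableSpace β]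
    {μ : Measure α} {ν : Measure β} [IsFiniteMeasure μ] [SFinite ν]
    {k : α → β → ℝ≥0∞} (hk : Measurable (Function.uncurry k))
    (hk2 : ∀ x, ∫⁻ z, k x z ∂ν ≤ 2) {γ : ℝ} (hγ0 : 0 < γ) (hγ1 : γ < 1) {C : ℝ≥0}
    (hB : ∀ Ω E, MeasurableSet Ω → MeasurableSet E →
      ∫⁻ x in Ω, ∫⁻ z in E, k x z ∂ν ∂μ ≤ C * (ν E * μ Ω) ^ γ)
    {p₁ : ℝ} (hp₁ : 1 < p₁ * γ) {f : β → ℝ≥0} (hf : Measurable f) :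
    μ {x | 3 < ∫⁻ z, k x z * f z ∂ν} ≤
      (((∑' j : ℕ, 2 * ((2 : ℝ≥0) ^ (1 - p₁ * γ)) ^ j) * C : ℝ≥0) : ℝ≥0∞) ^ (1 / (1 - γ)) *
        (∫⁻ z in {z | 1 < f z}, (f z : ℝ≥0∞) ^ p₁ ∂ν) ^ (γ / (1 - γ)) := by
  have hp₁0 : 0 < p₁ := by
    by_contra! h
    nlinarith
  have hkx : ∀ x, Measurable (k x) := fun x => hk.comp measurable_prodMk_left
  set U : α → ℝ≥0∞ := fun x => ∫⁻ z, k x z * f z ∂ν with hU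
  have hUm : Measurable U :=
    (hk.mul (hf.comp measurable_snd).coe_nnreal_ennreal).lintegral_prod_right'
  set E : ℕ → Set β := fun j => {z | 2 ^ j < f z} with hE
  have hEm : ∀ j, MeasurableSet (E j) := fun j => measurableSet_lt measurable_const hf
  set I := ∫⁻ z in {z | 1 < f z}, (f z : ℝ≥0∞) ^ p₁ ∂ν with hI
  set Ω := {x | 3 < U x} with hΩ
  have hΩm : MeasurableSet Ω := measurableSet_lt measurable_const hUm
  set m := μ Ω with hm
  have hUle : ∀ x, U x ≤ 2 + ∑' j : ℕ, (2 : ℝ≥0∞) ^ (j + 1) * ∫⁻ z in E j, k x z ∂ν := by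
    intro x
    calc U x ≤ ∫⁻ z, (k x z + ∑' j : ℕ, (2 : ℝ≥0∞) ^ (j + 1) * (E j).indicator (k x) z) ∂ν := by
          refine lintegral_mono fun z => ?_
          refine (mul_le_mul_right (coe_le_one_add_tsum_indicator f z) _).trans (le_of_eq ?_)
          rw [mul_add, mul_one, ← ENNReal.tsum_mul_left]
          congr 2 with j
          by_cases hz : z ∈ E j
          · rw [indicator_of_mem hz, indicator_of_mem (by exact hz)]
            simp [mul_comm]
          · rw [indicator_of_notMem hz, indicator_of_notMem (by exact hz)]
            simp
      _ = (∫⁻ z, k x z ∂ν) + ∑' j : ℕ, (2 : ℝ≥0∞) ^ (j + 1) * ∫⁻ z in E j, k x z ∂ν := by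
          rw [lintegral_add_left (hkx x), lintegral_tsum fun j =>
            (((hkx x).indicator (hEm j)).const_mul _).aemeasurable]
          congr 2 with j
          rw [lintegral_const_mul _ ((hkx x).indicator (hEm j)), lintegral_indicator (hEm j)]
      _ ≤ _ := by gcongr; exact hk2 x
  have hΩle : ∀ x ∈ Ω, 1 ≤ ∑' j : ℕ, (2 : ℝ≥0∞) ^ (j + 1) * ∫⁻ z in E j, k x z ∂ν := by
    intro x hx
    have h3 : (2 : ℝ≥0∞) + 1 ≤
        2 + ∑' j : ℕ, (2 : ℝ≥0∞) ^ (j + 1) * ∫⁻ z in E j, k x z ∂ν := by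
      rw [two_add_one_eq_three]
      exact (le_of_lt hx).trans (hUle x)
    exact (ENNReal.add_le_add_iff_left (by simp)).1 h3
  have hcheb : ∀ j, ν (E j) ≤ ((2 : ℝ≥0∞) ^ j) ^ (-p₁) * I := by
    intro j
    have h0 : ((2 : ℝ≥0∞) ^ j) ^ p₁ ≠ 0 := by simp
    have ht : ((2 : ℝ≥0∞) ^ j) ^ p₁ ≠ ⊤ :=
      ENNReal.rpow_ne_top_of_nonneg hp₁0.le (by simp)
    rw [ENNReal.rpow_neg, mul_comm, ← div_eq_mul_inv, ENNReal.le_div_iff_mul_le (.inl h0) (.inl ht)]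
    calc ν (E j) * ((2 : ℝ≥0∞) ^ j) ^ p₁ = ∫⁻ z in E j, ((2 : ℝ≥0∞) ^ j) ^ p₁ ∂ν := by
          rw [setLIntegral_const, mul_comm]
      _ ≤ ∫⁻ z in E j, (f z : ℝ≥0∞) ^ p₁ ∂ν := by
          refine setLIntegral_mono' (hEm j) fun z hz => ?_
          gcongr
          exact_mod_cast (show 2 ^ j < f z from hz).le
      _ ≤ I := by
          refine lintegral_mono_set fun z hz => ?_
          exact (one_le_pow₀ one_le_two).trans_lt (show 2 ^ j < f z from hz)
  have hq1 : (2 : ℝ≥0) ^ (1 - p₁ * γ) < 1 :=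
    NNReal.rpow_lt_one_of_one_lt_of_neg one_lt_two (by linarith)
  set q : ℝ≥0 := (2 : ℝ≥0) ^ (1 - p₁ * γ) with hq
  have hsum : Summable fun j : ℕ => 2 * q ^ j := (NNReal.summable_geometric hq1).mul_left 2
  have hmain : m ≤ (((∑' j : ℕ, 2 * q ^ j) * C : ℝ≥0) : ℝ≥0∞) * (I * m) ^ γ := by
    calc m = ∫⁻ x in Ω, 1 ∂μ := by simp [hm]
      _ ≤ ∫⁻ x in Ω, ∑' j : ℕ, (2 : ℝ≥0∞) ^ (j + 1) * ∫⁻ z in E j, k x z ∂ν ∂μ :=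
          setLIntegral_mono' hΩm hΩle
      _ = ∑' j : ℕ, (2 : ℝ≥0∞) ^ (j + 1) * ∫⁻ x in Ω, ∫⁻ z in E j, k x z ∂ν ∂μ := by
          have hmj : ∀ j, Measurable fun x => ∫⁻ z in E j, k x z ∂ν := fun j =>
            hk.lintegral_prod_right'
          rw [lintegral_tsum fun j => ((hmj j).const_mul _).aemeasurable]
          congr 1 with j
          rw [lintegral_const_mul _ (hmj j)]
      _ ≤ ∑' j : ℕ, (2 * q ^ j : ℝ≥0) * ((C : ℝ≥0∞) * (I * m) ^ γ) := by
          refine ENNReal.tsum_le_tsum fun j => ?_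
          calc (2 : ℝ≥0∞) ^ (j + 1) * ∫⁻ x in Ω, ∫⁻ z in E j, k x z ∂ν ∂μ
              ≤ (2 : ℝ≥0∞) ^ (j + 1) * (C * ((((2 : ℝ≥0∞) ^ j) ^ (-p₁) * I) * m) ^ γ) := by
                refine mul_le_mul_right ((hB Ω (E j) hΩm (hEm j)).trans ?_) _
                gcongr
                exact hcheb j
            _ = (2 : ℝ≥0∞) ^ (j + 1) * (((2 : ℝ≥0∞) ^ j) ^ (-p₁)) ^ γ * (C * (I * m) ^ γ) := by
                rw [mul_assoc (_ ^ (-p₁)), ENNReal.mul_rpow_of_nonneg _ _ hγ0.le]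
                ring
            _ = _ := by
                congr 1
                rw [pow_succ', mul_assoc, ← ENNReal.rpow_mul]
                push_cast
                congr 1
                rw [hq, ENNReal.coe_rpow_of_ne_zero two_ne_zero, ← ENNReal.rpow_natCast,
                  ← ENNReal.rpow_natCast, ← ENNReal.rpow_mul, ← ENNReal.rpow_mul, ENNReal.coe_ofNat,
                  ← ENNReal.rpow_add _ _ (by simp) (by simp)]
                congr 1
                ring
      _ = _ := by
          rw [ENNReal.tsum_mul_right, ← ENNReal.coe_tsum hsum]
          push_cast
          ring
  set C₀ : ℝ≥0 := (∑' j : ℕ, 2 * q ^ j) * C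
  rcases eq_or_ne m 0 with hm0 | hm0
  · rw [hm0]; exact zero_le
  have hmt : m ≠ ⊤ := measure_ne_top _ _
  have hm1 : m ^ (1 - γ) ≤ C₀ * I ^ γ := by
    rw [ENNReal.rpow_sub _ _ hm0 hmt, ENNReal.rpow_one]
    refine ENNReal.div_le_of_le_mul (hmain.trans (le_of_eq ?_))
    rw [ENNReal.mul_rpow_of_nonneg _ _ hγ0.le, mul_assoc]
  have h1γ : 0 < 1 - γ := by linarith
  calc m = (m ^ (1 - γ)) ^ (1 / (1 - γ)) := by
        rw [← ENNReal.rpow_mul, mul_one_div_cancel h1γ.ne', ENNReal.rpow_one]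
    _ ≤ (C₀ * I ^ γ) ^ (1 / (1 - γ)) := by gcongr
    _ = _ := by
        rw [ENNReal.mul_rpow_of_nonneg _ _ (by positivity), ← ENNReal.rpow_mul, mul_one_div]

open scoped ENNReal in
lemma ENNReal.rpow_eq_rpow_sub_one_mul (b : ℝ≥0∞) {s : ℝ} (hs : 1 ≤ s) :
    b ^ s = b ^ (s - 1) * b := by
  conv_rhs => rw [← ENNReal.rpow_one b, ← ENNReal.rpow_mul, one_mul,
    ← ENNReal.rpow_add_of_nonneg _ _ (by linarith) zero_le_one]
  simp

open scoped ENNReal NNReal in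
/-- Interpolation of a restricted bilinear bound with the trivial `L^∞` bound. -/
lemma exists_lintegral_rpow_le_of_restricted {γ p₁ p : ℝ} (hγ0 : 1 / 2 ≤ γ) (hγ1 : γ < 1)
    (hp₁ : 1 < p₁ * γ) (hp : p₁ < p) (C : ℝ≥0) :
    ∃ C' : ℝ≥0, ∀ {α β : Type} [MeasurableSpace α] [MeasurableSpace β]
      {μ : Measure α} {ν : Measure β} [IsFiniteMeasure μ] [SFinite ν]
      {k : α → β → ℝ≥0∞}, Measurable (Function.uncurry k) → (∀ x, ∫⁻ z, k x z ∂ν ≤ 2) →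
      (∀ Ω E, MeasurableSet Ω → MeasurableSet E →
        ∫⁻ x in Ω, ∫⁻ z in E, k x z ∂ν ∂μ ≤ C * (ν E * μ Ω) ^ γ) →
      ∀ {f : β → ℝ≥0}, Measurable f → ∀ M : ℝ≥0, (∀ z, f z ≤ M) →
        ∫⁻ x, (∫⁻ z, k x z * f z ∂ν) ^ (p * (γ / (1 - γ))) ∂μ ≤
          C' * (∫⁻ z, (f z : ℝ≥0∞) ^ p ∂ν) ^ (γ / (1 - γ)) := by
  have h1γ : 0 < 1 - γ := by linarith
  have hp₁0 : 0 < p₁ := by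
    by_contra! h
    nlinarith
  set κ := γ / (1 - γ) with hκ
  have hκ1 : 1 ≤ κ := by rw [hκ, le_div_iff₀ h1γ]; linarith
  set C₀ : ℝ≥0 := ((∑' j : ℕ, 2 * ((2 : ℝ≥0) ^ (1 - p₁ * γ)) ^ j) * C) ^ (1 / (1 - γ)) with hC₀
  refine ⟨3 ^ (p * κ) * Real.toNNReal (p * κ) * C₀ * (Real.toNNReal (p - p₁))⁻¹, ?_⟩
  intro α β _ _ μ ν _ _ k hk hk2 hB f hf M hM
  have hQ : 0 < p * κ := by have := hp₁0.trans hp; positivity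
  set U : α → ℝ≥0∞ := fun x => ∫⁻ z, k x z * f z ∂ν with hU
  have hUm : Measurable U :=
    (hk.mul (hf.comp measurable_snd).coe_nnreal_ennreal).lintegral_prod_right'
  have hUfin : ∀ x, U x ≠ ⊤ := fun x => by
    refine ne_top_of_le_ne_top (b := 2 * (M : ℝ≥0∞)) (by finiteness) ?_
    calc U x ≤ ∫⁻ z, k x z * M ∂ν := by
          refine lintegral_mono fun z => ?_
          gcongr
          exact hM z
      _ = (∫⁻ z, k x z ∂ν) * M := lintegral_mul_const _ (hk.comp measurable_prodMk_left)
      _ ≤ _ := by gcongr; exact hk2 x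
  set F := ∫⁻ z, (f z : ℝ≥0∞) ^ p ∂ν with hF
  set I : ℝ → ℝ≥0∞ := fun t => ∫⁻ z in {z | t < f z}, (f z : ℝ≥0∞) ^ p₁ ∂ν with hI
  have hset : ∀ t : ℝ, MeasurableSet {z | t < f z} := fun t =>
    measurableSet_lt measurable_const hf.coe_nnreal_real
  have hIF : ∀ t : ℝ, 0 < t → I t ≤ ENNReal.ofReal t ^ (p₁ - p) * F := by
    intro t ht
    rw [hF, ← lintegral_const_mul _ (hf.coe_nnreal_ennreal.pow_const _)]
    refine (setLIntegral_mono' (hset t) fun z hz => ?_).trans (setLIntegral_le_lintegral _ _)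
    have hz' : ENNReal.ofReal t ≤ f z := by
      rw [← ENNReal.ofReal_coe_nnreal]
      exact ENNReal.ofReal_le_ofReal (le_of_lt hz)
    have hz0 : (f z : ℝ≥0∞) ≠ 0 := (lt_of_lt_of_le (by simpa using ht) hz').ne'
    calc (f z : ℝ≥0∞) ^ p₁ = (f z : ℝ≥0∞) ^ (p₁ - p) * (f z : ℝ≥0∞) ^ p := by
          rw [← ENNReal.rpow_add _ _ hz0 (by simp)]
          congr 1; ring
      _ ≤ _ := by
          gcongr ?_ * _
          rw [← neg_sub p p₁, ENNReal.rpow_neg, ENNReal.rpow_neg, ENNReal.inv_le_inv]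
          exact ENNReal.rpow_le_rpow hz' (by linarith)
  have hdist : ∀ t : ℝ, 0 < t → μ {x | t < (U x).toReal / 3} * ENNReal.ofReal (t ^ (p * κ - 1)) ≤
      C₀ * F ^ (κ - 1) * (I t * ENNReal.ofReal (t ^ (p - p₁ - 1))) := by
    intro t ht
    set T := ENNReal.ofReal t with hT
    have hT0 : T ≠ 0 := by simpa [hT] using ht
    have hTt : T ≠ ⊤ := by simp [hT]
    have hTn : T = (Real.toNNReal t : ℝ≥0∞) := rfl
    set τ := Real.toNNReal t with hτ
    have hτ0 : τ ≠ 0 := by simpa [hτ] using ht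
    have h := measure_lt_le_of_restricted hk hk2 (by linarith) hγ1 hB hp₁
      (f := fun z => f z / τ) (hf.div_const _)
    have hL : {x | t < (U x).toReal / 3} = {x | 3 < ∫⁻ z, k x z * (f z / τ : ℝ≥0) ∂ν} := by
      ext x
      have : ∫⁻ z, k x z * (f z / τ : ℝ≥0) ∂ν = U x / T := by
        simp only [hU, div_eq_mul_inv, ENNReal.coe_mul, ENNReal.coe_inv hτ0, ← mul_assoc, ← hTn]
        rw [lintegral_mul_const' _ _ (by simpa using hT0)]
      rw [mem_ofPred_eq, mem_ofPred_eq, this, ENNReal.lt_div_iff_mul_lt (.inl hT0) (.inl hTt),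
        lt_div_iff₀ (by norm_num : (0 : ℝ) < 3), ← ENNReal.ofReal_lt_iff_lt_toReal (by positivity)
        (hUfin x), ENNReal.ofReal_mul ht.le, mul_comm]
      simp [hT]
    have hR : ∫⁻ z in {z | 1 < f z / τ}, ((f z / τ : ℝ≥0) : ℝ≥0∞) ^ p₁ ∂ν = T ^ (-p₁) * I t := by
      have hs : {z | 1 < f z / τ} = {z | t < f z} := by
        ext z
        rw [mem_ofPred_eq, mem_ofPred_eq, lt_div_iff₀ (pos_iff_ne_zero.2 hτ0), one_mul, hτ,
          Real.toNNReal_lt_iff_lt_coe ht.le]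
      rw [hs, hI, ← lintegral_const_mul _ (hf.coe_nnreal_ennreal.pow_const _)]
      congr 1 with z
      rw [ENNReal.coe_div hτ0, ENNReal.div_rpow_of_nonneg _ _ hp₁0.le, ENNReal.rpow_neg, ← hTn,
        div_eq_mul_inv, mul_comm]
    rw [hL]
    rw [hR, ← hκ, ← ENNReal.coe_rpow_of_nonneg _ (by positivity), ← hC₀] at h
    rw [← ENNReal.ofReal_rpow_of_pos ht, ← ENNReal.ofReal_rpow_of_pos ht]
    calc _ ≤ C₀ * (T ^ (-p₁) * I t) ^ κ * T ^ (p * κ - 1) := by gcongr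
      _ = C₀ * T ^ (-p₁ * κ + (p * κ - 1)) * (I t ^ (κ - 1) * I t) := by
          rw [ENNReal.mul_rpow_of_nonneg _ _ (by linarith), ← ENNReal.rpow_mul,
            ENNReal.rpow_add _ _ hT0 hTt]
          rw [ENNReal.rpow_eq_rpow_sub_one_mul (I t) hκ1]
          ring
      _ ≤ C₀ * T ^ (-p₁ * κ + (p * κ - 1)) * ((T ^ (p₁ - p) * F) ^ (κ - 1) * I t) := by
          gcongr
          exact hIF t ht
      _ = C₀ * F ^ (κ - 1) * (I t * (T ^ (-p₁ * κ + (p * κ - 1)) * T ^ ((p₁ - p) * (κ - 1)))) := by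
          rw [ENNReal.mul_rpow_of_nonneg _ _ (by linarith), ← ENNReal.rpow_mul]
          ring
      _ = _ := by
          rw [← ENNReal.rpow_add _ _ hT0 hTt]
          congr 3
          ring
  have hlayer : ENNReal.ofReal (p - p₁) *
      ∫⁻ t in Ioi (0 : ℝ), I t * ENNReal.ofReal (t ^ (p - p₁ - 1)) = F := by
    have hw : Measurable fun z => (f z : ℝ≥0∞) ^ p₁ := hf.coe_nnreal_ennreal.pow_const _
    have h := lintegral_rpow_eq_lintegral_meas_lt_mul
      (ν.withDensity fun z => (f z : ℝ≥0∞) ^ p₁) (f := fun z => (f z : ℝ))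
      (Eventually.of_forall fun z => (f z).coe_nonneg) hf.coe_nnreal_real.aemeasurable
      (p := p - p₁) (by linarith)
    simp only [withDensity_apply _ (hset _)] at h
    rw [← h, lintegral_withDensity_eq_lintegral_mul _ hw
      ((hf.coe_nnreal_real.pow_const _).ennreal_ofReal)]
    refine lintegral_congr fun z => ?_
    rw [Pi.mul_apply, ← ENNReal.ofReal_rpow_of_nonneg (f z).coe_nonneg (by linarith),
      ENNReal.ofReal_coe_nnreal, ← ENNReal.rpow_add_of_nonneg _ _ hp₁0.le (by linarith)]
    congr 1; ring
  have hlU := lintegral_rpow_eq_lintegral_meas_lt_mul μ (f := fun x => (U x).toReal / 3)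
    (Eventually.of_forall fun x => by positivity) (hUm.ennreal_toReal.div_const 3).aemeasurable hQ
  have hpp : ENNReal.ofReal (p - p₁) ≠ 0 := by simpa using hp
  calc ∫⁻ x, U x ^ (p * κ) ∂μ
      = ∫⁻ x, 3 ^ (p * κ) * ENNReal.ofReal (((U x).toReal / 3) ^ (p * κ)) ∂μ := by
        refine lintegral_congr fun x => ?_
        rw [← ENNReal.ofReal_rpow_of_nonneg (by positivity) hQ.le,
          ← ENNReal.mul_rpow_of_nonneg _ _ hQ.le]
        congr 1
        rw [ENNReal.ofReal_div_of_pos (by norm_num), ENNReal.ofReal_toReal (hUfin x)]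
        simp [ENNReal.mul_div_cancel]
    _ = 3 ^ (p * κ) * (ENNReal.ofReal (p * κ) * ∫⁻ t in Ioi 0,
          μ {x | t < (U x).toReal / 3} * ENNReal.ofReal (t ^ (p * κ - 1))) := by
        rw [lintegral_const_mul' _ _ (by finiteness), hlU]
    _ ≤ 3 ^ (p * κ) * (ENNReal.ofReal (p * κ) * ∫⁻ t in Ioi 0,
          C₀ * F ^ (κ - 1) * (I t * ENNReal.ofReal (t ^ (p - p₁ - 1)))) := by
        gcongr 3 ^ (p * κ) * (ENNReal.ofReal (p * κ) * ?_)
        exact setLIntegral_mono' measurableSet_Ioi fun t ht => hdist t ht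
    _ = 3 ^ (p * κ) * (ENNReal.ofReal (p * κ) * (C₀ * F ^ (κ - 1) *
          ∫⁻ t in Ioi 0, I t * ENNReal.ofReal (t ^ (p - p₁ - 1)))) := by
        rw [lintegral_const_mul]
        have hIa : Antitone I := fun s t hst => lintegral_mono_set fun z hz => hst.trans_lt hz
        exact hIa.measurable.mul ((measurable_id.pow_const _).ennreal_ofReal)
    _ = 3 ^ (p * κ) * (ENNReal.ofReal (p * κ) * (C₀ * F ^ (κ - 1) *
          ((ENNReal.ofReal (p - p₁))⁻¹ * F))) := by
        congr 3
        rw [← hlayer, ← mul_assoc, ENNReal.inv_mul_cancel hpp (by simp), one_mul]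
    _ = _ := by
        rw [ENNReal.rpow_eq_rpow_sub_one_mul F hκ1]
        push_cast
        rw [ENNReal.coe_inv (by simpa using hp), ENNReal.coe_rpow_of_nonneg _ hQ.le]
        simp only [ENNReal.ofReal, ENNReal.coe_ofNat]
        ring

open scoped ENNReal in
lemma lintegral_eq_mul_lintegral_add_mul {G : ℝ → ℝ≥0∞} (hG : Measurable G) {r : ℝ} (hr : 0 < r)
    (x : ℝ) : ∫⁻ z, G z = ENNReal.ofReal r * ∫⁻ y, G (x + r * y) := by
  have hGx : Measurable fun z => G (x + z) := hG.comp (measurable_const_add x)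
  rw [← lintegral_add_left_eq_self G x]
  conv_lhs => rw [← Real.smul_map_volume_mul_left hr.ne']
  rw [lintegral_smul_measure, lintegral_map hGx (measurable_const_mul r), abs_of_pos hr,
    smul_eq_mul]

open scoped ENNReal in
lemma lintegral_dilated_eq_ofReal {N r : ℝ → ℝ} {B : ℝ} (hN : Measurable N) (hN0 : ∀ t, 0 ≤ N t)
    (hNB : ∀ t, N t ≤ B) (hr : Measurable r) {Ω E : Set ℝ}
    (hΩf : volume Ω ≠ ⊤) (hEf : volume E ≠ ⊤) :
    ∫⁻ x in Ω, ∫⁻ z in E, ENNReal.ofReal (N ((z - x) / r x)) =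
      ENNReal.ofReal (∫ z in E, ∫ x in Ω, N ((z - x) / r x)) := by
  have hm := measurable_dilated hN hr
  have : IsFiniteMeasure (volume.restrict Ω) := isFiniteMeasure_restrict.2 hΩf
  have : IsFiniteMeasure (volume.restrict E) := isFiniteMeasure_restrict.2 hEf
  have hInt : Integrable (fun w : ℝ × ℝ => N ((w.2 - w.1) / r w.1))
      ((volume.restrict Ω).prod (volume.restrict E)) :=
    .of_bound hm.aestronglyMeasurable B (Eventually.of_forall fun w => by
      rw [Real.norm_of_nonneg (hN0 _)]; exact hNB _)
  rw [lintegral_lintegral hm.ennreal_ofReal.aemeasurable,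
    ← ofReal_integral_eq_lintegral_ofReal hInt (Eventually.of_forall fun w => hN0 _),
    integral_prod_symm _ hInt]

open scoped ENNReal NNReal in
/-- The `L^p → L^Q` bound on the unit interval for averages along a measurable choice of dilations,
deduced from a restricted bilinear bound. -/
lemma exists_lintegral_average_rpow_le {γ p₁ p : ℝ} (hγ0 : 1 / 2 ≤ γ) (hγ1 : γ < 1)
    (hp₁ : 1 < p₁ * γ) (hp : p₁ < p) {C : ℝ} (hC : 0 ≤ C) :
    ∃ C' : ℝ≥0, ∀ (N : ℝ → ℝ) (B : ℝ), Measurable N → (∀ t, 0 ≤ N t) → (∀ t, N t ≤ B) →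
      (∀ t, t ∉ Icc (1 : ℝ) 2 → N t = 0) → ∫⁻ t, ENNReal.ofReal (N t) ≤ 1 →
      ∀ r : ℝ → ℝ, Measurable r → (∀ t, r t ∈ Icc (1 : ℝ) 2) →
      (∀ Ω E : Set ℝ, MeasurableSet Ω → Ω ⊆ Icc 0 1 → MeasurableSet E → E ⊆ Icc 1 5 →
        (∫ z in E, ∫ x in Ω, N ((z - x) / r x)) ≤
          C * ((volume E).toReal * (volume Ω).toReal) ^ γ) →
      ∀ f : ℝ → ℝ≥0, Measurable f → ∀ M : ℝ≥0, (∀ z, f z ≤ M) →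
        ∫⁻ x in Icc 0 1, (∫⁻ y, f (x + r x * y) * ENNReal.ofReal (N y)) ^ (p * (γ / (1 - γ))) ≤
          C' * (∫⁻ z in Icc 1 5, (f z : ℝ≥0∞) ^ p) ^ (γ / (1 - γ)) := by
  obtain ⟨C', hC'⟩ := exists_lintegral_rpow_le_of_restricted hγ0 hγ1 hp₁ hp C.toNNReal
  refine ⟨C', fun N B hN hN0 hNB hNs hN1 r hr hr12 hb f hf M hM => ?_⟩
  have hQ : 0 ≤ p * (γ / (1 - γ)) := by
    have hγ : 0 < γ := by linarith
    have : 0 < p₁ := by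
      by_contra! h
      nlinarith
    have : 0 < 1 - γ := by linarith
    have : 0 < p := by linarith
    positivity
  have hr0 : ∀ x, 0 < r x := fun x => zero_lt_one.trans_le (hr12 x).1
  have hm := measurable_dilated hN hr
  have hsec : ∀ x, Measurable fun z => ENNReal.ofReal (N ((z - x) / r x)) := fun x =>
    (hm.comp measurable_prodMk_left).ennreal_ofReal
  have hcancel : ∀ x y, (x + r x * y - x) / r x = y := fun x y => by
    rw [add_sub_cancel_left, mul_div_cancel_left₀ _ (hr0 x).ne']
  refine le_trans ?_ (hC' (μ := volume.restrict (Icc 0 1)) (ν := volume.restrict (Icc (1 : ℝ) 5))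
    (k := fun x z => ENNReal.ofReal (N ((z - x) / r x))) hm.ennreal_ofReal ?_ ?_ hf M hM)
  · refine setLIntegral_mono' measurableSet_Icc fun x hx => ?_
    refine ENNReal.rpow_le_rpow ?_ hQ
    have hsupp : ∫⁻ z in Icc 1 5, ENNReal.ofReal (N ((z - x) / r x)) * f z =
        ∫⁻ z, ENNReal.ofReal (N ((z - x) / r x)) * f z := by
      refine setLIntegral_eq_of_support_subset ?_
      intro z hz
      by_contra hz5
      refine hz ?_
      have : (z - x) / r x ∉ Icc (1 : ℝ) 2 := by
        intro h
        rw [mem_Icc, le_div_iff₀ (hr0 x), div_le_iff₀ (hr0 x)] at h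
        have := (hr12 x).1
        have := (hr12 x).2
        exact hz5 ⟨by linarith [hx.1], by linarith [hx.2]⟩
      simp [hNs _ this]
    have hmeas : Measurable fun z => ENNReal.ofReal (N ((z - x) / r x)) * f z :=
      (hsec x).mul hf.coe_nnreal_ennreal
    rw [hsupp, lintegral_eq_mul_lintegral_add_mul hmeas (hr0 x) x]
    calc ∫⁻ y, f (x + r x * y) * ENNReal.ofReal (N y)
        = 1 * ∫⁻ y, ENNReal.ofReal (N ((x + r x * y - x) / r x)) * f (x + r x * y) := by
          rw [one_mul]
          refine lintegral_congr fun y => ?_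
          rw [hcancel, mul_comm]
      _ ≤ _ := by
          gcongr
          exact ENNReal.one_le_ofReal.2 (hr12 x).1
  · intro x
    refine (setLIntegral_le_lintegral _ _).trans ?_
    rw [lintegral_eq_mul_lintegral_add_mul (hsec x) (hr0 x) x]
    simp only [hcancel]
    calc ENNReal.ofReal (r x) * ∫⁻ y, ENNReal.ofReal (N y) ≤ ENNReal.ofReal 2 * 1 := by
          gcongr
          exact (hr12 x).2
      _ = 2 := by simp
  · intro Ω E hΩ hE
    rw [Measure.restrict_restrict hΩ, Measure.restrict_restrict hE, Measure.restrict_apply hΩ,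
      Measure.restrict_apply hE]
    have hΩf : volume (Ω ∩ Icc (0 : ℝ) 1) ≠ ⊤ :=
      measure_ne_top_of_subset inter_subset_right (by simp)
    have hEf : volume (E ∩ Icc (1 : ℝ) 5) ≠ ⊤ :=
      measure_ne_top_of_subset inter_subset_right (by simp)
    rw [lintegral_dilated_eq_ofReal hN hN0 hNB hr hΩf hEf]
    refine (ENNReal.ofReal_le_ofReal (hb _ _ (hΩ.inter measurableSet_Icc) inter_subset_right
      (hE.inter measurableSet_Icc) inter_subset_right)).trans (le_of_eq ?_)
    rw [ENNReal.ofReal_mul hC, ← ENNReal.ofReal_rpow_of_nonneg (by positivity) (by linarith),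
      ENNReal.ofReal_mul ENNReal.toReal_nonneg, ENNReal.ofReal_toReal hEf,
      ENNReal.ofReal_toReal hΩf]
    rfl

open scoped ENNReal NNReal in
lemma tendsto_lintegral_mul_ofReal_of_weak {N : ℕ → ℝ → ℝ} (hNi : ∀ n, Integrable (N n))
    (hN0 : ∀ n t, 0 ≤ N n t) {ν : Measure ℝ} [IsFiniteMeasure ν]
    (hweak : ∀ g : ℝ → ℝ, Continuous g → (∃ M, ∀ x, |g x| ≤ M) →
      Tendsto (fun n => ∫ x, g x * N n x) atTop (nhds (∫ x, g x ∂ν)))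
    {g : ℝ → ℝ≥0} (hg : Continuous g) {M : ℝ≥0} (hM : ∀ x, g x ≤ M) :
    Tendsto (fun n => ∫⁻ y, g y * ENNReal.ofReal (N n y)) atTop (nhds (∫⁻ y, g y ∂ν)) := by
  have hgr : Continuous fun x => (g x : ℝ) := NNReal.continuous_coe.comp hg
  have hgM : ∀ x, |(g x : ℝ)| ≤ M := fun x => by
    rw [abs_of_nonneg (g x).coe_nonneg]; exact hM x
  have h := ENNReal.tendsto_ofReal (hweak _ hgr ⟨M, hgM⟩)
  rw [ofReal_integral_eq_lintegral_ofReal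
    (.of_bound hgr.aestronglyMeasurable M (Eventually.of_forall hgM))
    (Eventually.of_forall fun x => (g x).coe_nonneg)] at h
  simp only [ENNReal.ofReal_coe_nnreal] at h
  convert h using 2 with n
  rw [ofReal_integral_eq_lintegral_ofReal
    ((hNi n).bdd_mul hgr.aestronglyMeasurable (Eventually.of_forall hgM))
    (Eventually.of_forall fun x => mul_nonneg (g x).coe_nonneg (hN0 n x))]
  refine lintegral_congr fun y => ?_
  rw [ENNReal.ofReal_mul (g y).coe_nonneg, ENNReal.ofReal_coe_nnreal]

open scoped ENNReal NNReal in
lemma lintegral_average_rpow_le_of_weak {N : ℕ → ℝ → ℝ} (hNm : ∀ n, Measurable (N n))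
    (hNi : ∀ n, Integrable (N n)) (hN0 : ∀ n t, 0 ≤ N n t) {ν : Measure ℝ} [IsFiniteMeasure ν]
    (hweak : ∀ g : ℝ → ℝ, Continuous g → (∃ M, ∀ x, |g x| ≤ M) →
      Tendsto (fun n => ∫ x, g x * N n x) atTop (nhds (∫ x, g x ∂ν)))
    {f : ℝ → ℝ≥0} (hf : Continuous f) {M : ℝ≥0} (hM : ∀ x, f x ≤ M) {r : ℝ → ℝ}
    (hr : Measurable r) {Q : ℝ} {s : Set ℝ} {D : ℝ≥0∞}
    (hb : ∀ n, ∫⁻ x in s, (∫⁻ y, f (x + r x * y) * ENNReal.ofReal (N (n + 1) y)) ^ Q ≤ D) :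
    ∫⁻ x in s, (∫⁻ y, f (x + r x * y) ∂ν) ^ Q ≤ D := by
  have hlim : ∀ x, Tendsto (fun n => (∫⁻ y, f (x + r x * y) * ENNReal.ofReal (N (n + 1) y)) ^ Q)
      atTop (nhds ((∫⁻ y, f (x + r x * y) ∂ν) ^ Q)) := fun x =>
    (ENNReal.continuous_rpow_const.tendsto _).comp <| (tendsto_add_atTop_iff_nat 1).2 <|
      tendsto_lintegral_mul_ofReal_of_weak hNi hN0 hweak (g := fun y => f (x + r x * y))
        (by fun_prop) fun _ => hM _
  have hmeas : ∀ n, Measurable fun x =>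
      (∫⁻ y, f (x + r x * y) * ENNReal.ofReal (N (n + 1) y)) ^ Q := fun n => by
    refine Measurable.pow_const ?_ _
    refine Measurable.lintegral_prod_right' (f := fun w : ℝ × ℝ =>
      (f (w.1 + r w.1 * w.2) : ℝ≥0∞) * ENNReal.ofReal (N (n + 1) w.2)) ?_
    refine Measurable.mul ?_ ((hNm _).comp measurable_snd).ennreal_ofReal
    exact (hf.measurable.comp (measurable_fst.add
      ((hr.comp measurable_fst).mul measurable_snd))).coe_nnreal_ennreal
  calc ∫⁻ x in s, (∫⁻ y, f (x + r x * y) ∂ν) ^ Q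
      = ∫⁻ x in s, liminf (fun n =>
          (∫⁻ y, f (x + r x * y) * ENNReal.ofReal (N (n + 1) y)) ^ Q) atTop :=
        lintegral_congr fun x => (hlim x).liminf_eq.symm
    _ ≤ liminf (fun n => ∫⁻ x in s,
          (∫⁻ y, f (x + r x * y) * ENNReal.ofReal (N (n + 1) y)) ^ Q) atTop :=
        lintegral_liminf_le hmeas
    _ ≤ D := liminf_le_of_frequently_le' (Frequently.of_forall hb)

open scoped ENNReal in
lemma ENNReal.tsum_rpow_le_rpow_tsum {ι : Type*} (a : ι → ℝ≥0∞) {s : ℝ} (hs : 1 ≤ s) :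
    ∑' i, a i ^ s ≤ (∑' i, a i) ^ s := by
  have h : ∀ b : ℝ≥0∞, b ^ s = b ^ (s - 1) * b := fun b => b.rpow_eq_rpow_sub_one_mul hs
  calc ∑' i, a i ^ s = ∑' i, a i ^ (s - 1) * a i := by simp only [h]
    _ ≤ ∑' i, (∑' j, a j) ^ (s - 1) * a i := by
        refine ENNReal.tsum_le_tsum fun i => ?_
        gcongr
        exact ENNReal.le_tsum i
    _ = _ := by rw [ENNReal.tsum_mul_left, ← h]

lemma setLIntegral_Icc_add_right (F : ℝ → ENNReal) (a b c : ℝ) :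
    ∫⁻ x in Icc (a + c) (b + c), F x = ∫⁻ x in Icc a b, F (x + c) := by
  rw [← (measurePreserving_add_right volume c).setLIntegral_comp_preimage_emb
    (measurableEmbedding_addRight c) F, preimage_add_const_Icc, add_sub_cancel_right,
    add_sub_cancel_right]

lemma tsum_setLIntegral_Ico_intCast (F : ℝ → ENNReal) :
    ∑' m : ℤ, ∫⁻ x in Ico (m : ℝ) (m + 1), F x = ∫⁻ x, F x := by
  rw [← lintegral_iUnion (fun m : ℤ => measurableSet_Ico) (pairwise_disjoint_Ico_intCast ℝ),
    iUnion_Ico_intCast, setLIntegral_univ]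

lemma tsum_setLIntegral_Icc_intCast_le (F : ℝ → ENNReal) :
    ∑' m : ℤ, ∫⁻ x in Icc (1 + m : ℝ) (5 + m), F x ≤ 5 * ∫⁻ x, F x := by
  calc ∑' m : ℤ, ∫⁻ x in Icc (1 + m : ℝ) (5 + m), F x
      ≤ ∑' m : ℤ, ∑' j : Fin 5, ∫⁻ x in Ico (((m + (j + 1) : ℤ) : ℝ)) (((m + (j + 1) : ℤ) : ℝ) + 1),
          F x := by
        refine ENNReal.tsum_le_tsum fun m => (lintegral_mono_set fun x hx => ?_).trans
          (lintegral_iUnion_le _ _)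
        have h1 : m + 1 ≤ ⌊x⌋ := Int.le_floor.2 (by push_cast; linarith [hx.1])
        have h5 : ⌊x⌋ < m + 6 := Int.floor_lt.2 (by push_cast; linarith [hx.2])
        obtain ⟨j, hj⟩ := Int.eq_ofNat_of_zero_le (show 0 ≤ ⌊x⌋ - m - 1 by omega)
        refine mem_iUnion.2 ⟨⟨j, by omega⟩, ?_⟩
        rw [show m + (((⟨j, by omega⟩ : Fin 5) : ℕ) + 1 : ℤ) = ⌊x⌋ by simp only []; omega]
        exact ⟨Int.floor_le x, Int.lt_floor_add_one x⟩
    _ = ∑' j : Fin 5, ∫⁻ x, F x := by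
        rw [ENNReal.tsum_comm]
        refine tsum_congr fun j => ?_
        rw [← tsum_setLIntegral_Ico_intCast F]
        exact (Equiv.addRight ((j : ℤ) + 1)).tsum_eq
          (fun m : ℤ => ∫⁻ x in Ico (m : ℝ) (m + 1), F x)
    _ = _ := by simp

open scoped ENNReal in
lemma setLIntegral_Icc_rpow_le_rpow {F : ℝ → ℝ≥0∞} (hF : Measurable F) {q Q : ℝ} (hq : 0 < q)
    (hqQ : q ≤ Q) : ∫⁻ x in Icc 0 1, F x ^ q ≤ (∫⁻ x in Icc 0 1, F x ^ Q) ^ (q / Q) := by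
  have : IsProbabilityMeasure (volume.restrict (Icc (0 : ℝ) 1)) := ⟨by simp⟩
  have h := eLpNorm'_le_eLpNorm'_of_exponent_le hq hqQ (volume.restrict (Icc (0 : ℝ) 1))
    hF.aestronglyMeasurable
  simp only [eLpNorm', enorm_eq_self] at h
  calc ∫⁻ x in Icc 0 1, F x ^ q = ((∫⁻ x in Icc 0 1, F x ^ q) ^ (1 / q)) ^ q := by
        rw [← ENNReal.rpow_mul, one_div_mul_cancel hq.ne', ENNReal.rpow_one]
    _ ≤ ((∫⁻ x in Icc 0 1, F x ^ Q) ^ (1 / Q)) ^ q := by gcongr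
    _ = _ := by rw [← ENNReal.rpow_mul, one_div_mul_eq_div]

open scoped ENNReal NNReal in
/-- Local bounds on unit intervals add up to a global bound. -/
lemma lintegral_average_rpow_le_of_local {ν : Measure ℝ} [IsFiniteMeasure ν] {p q κ : ℝ}
    (hp : 0 < p) (hpq : p ≤ q) (hq : q ≤ p * κ) {C : ℝ≥0}
    (hloc : ∀ r : ℝ → ℝ, Measurable r → (∀ t, r t ∈ Icc (1 : ℝ) 2) →
      ∀ f : ℝ → ℝ≥0, Continuous f → ∀ M : ℝ≥0, (∀ z, f z ≤ M) →
        ∫⁻ x in Icc 0 1, (∫⁻ y, f (x + r x * y) ∂ν) ^ (p * κ) ≤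
          C * (∫⁻ z in Icc 1 5, (f z : ℝ≥0∞) ^ p) ^ κ)
    {r : ℝ → ℝ} (hr : Measurable r) (hr12 : ∀ t, r t ∈ Icc (1 : ℝ) 2)
    {f : ℝ → ℝ≥0} (hf : Continuous f) {M : ℝ≥0} (hM : ∀ z, f z ≤ M) :
    ∫⁻ x, (∫⁻ y, f (x + r x * y) ∂ν) ^ q ≤
      C ^ (q / (p * κ)) * (5 * ∫⁻ z, (f z : ℝ≥0∞) ^ p) ^ (q / p) := by
  have hq0 : 0 < q := hp.trans_le hpq
  have hQ : 0 < p * κ := hq0.trans_le hq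
  set F : ℝ → ℝ≥0∞ := fun x => ∫⁻ y, f (x + r x * y) ∂ν with hF
  have hFm : Measurable F := Measurable.lintegral_prod_right'
    (f := fun w : ℝ × ℝ => (f (w.1 + r w.1 * w.2) : ℝ≥0∞))
    (hf.measurable.comp (measurable_fst.add
      ((hr.comp measurable_fst).mul measurable_snd))).coe_nnreal_ennreal
  have hunit : ∀ m : ℤ, ∫⁻ x in Ico (m : ℝ) (m + 1), F x ^ q ≤
      C ^ (q / (p * κ)) * (∫⁻ z in Icc (1 + m : ℝ) (5 + m), (f z : ℝ≥0∞) ^ p) ^ (q / p) := by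
    intro m
    calc ∫⁻ x in Ico (m : ℝ) (m + 1), F x ^ q ≤ ∫⁻ x in Icc (0 + m : ℝ) (1 + m), F x ^ q := by
          rw [zero_add, add_comm (1 : ℝ)]
          exact lintegral_mono_set Ico_subset_Icc_self
      _ = ∫⁻ x in Icc 0 1, F (x + m) ^ q := setLIntegral_Icc_add_right _ _ _ _
      _ ≤ (∫⁻ x in Icc 0 1, F (x + m) ^ (p * κ)) ^ (q / (p * κ)) :=
          setLIntegral_Icc_rpow_le_rpow (hFm.comp (measurable_add_const _)) hq0 hq
      _ ≤ (C * (∫⁻ z in Icc 1 5, (f (z + m) : ℝ≥0∞) ^ p) ^ κ) ^ (q / (p * κ)) := by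
          gcongr
          refine le_trans (le_of_eq ?_) (hloc (fun x => r (x + m))
            (hr.comp (measurable_add_const _)) (fun t => hr12 _) (fun x => f (x + m))
            (by fun_prop) M fun z => hM _)
          simp only [hF]
          congr! 7
          ring
      _ = _ := by
          rw [ENNReal.mul_rpow_of_nonneg _ _ (by positivity), ← ENNReal.rpow_mul,
            setLIntegral_Icc_add_right fun z => (f z : ℝ≥0∞) ^ p]
          congr 2
          have : κ ≠ 0 := by rintro rfl; simp at hQ
          field_simp
  calc ∫⁻ x, F x ^ q = ∑' m : ℤ, ∫⁻ x in Ico (m : ℝ) (m + 1), F x ^ q :=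
        (tsum_setLIntegral_Ico_intCast _).symm
    _ ≤ ∑' m : ℤ, C ^ (q / (p * κ)) *
          (∫⁻ z in Icc (1 + m : ℝ) (5 + m), (f z : ℝ≥0∞) ^ p) ^ (q / p) :=
        ENNReal.tsum_le_tsum hunit
    _ ≤ _ := by
        rw [ENNReal.tsum_mul_left]
        gcongr
        refine (ENNReal.tsum_rpow_le_rpow_tsum _ ((one_le_div hp).2 hpq)).trans ?_
        gcongr
        exact tsum_setLIntegral_Icc_intCast_le _

open scoped ENNReal NNReal in
/-- A lower semicontinuous function is an increasing limit of bounded continuous functions. -/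
lemma LowerSemicontinuous.exists_monotone_continuous_iSup_eq {X : Type*} [PseudoMetricSpace X]
    {g : X → ℝ≥0∞} (hg : LowerSemicontinuous g) :
    ∃ f : ℕ → X → ℝ≥0, Monotone f ∧ (∀ n, Continuous (f n)) ∧ (∀ n x, f n x ≤ n) ∧
      ∀ x, ⨆ n, (f n x : ℝ≥0∞) = g x := by
  set h : ℕ → X → ℝ≥0 := fun n y => (min (g y) n).toNNReal with hh
  have hcoe : ∀ n y, (h n y : ℝ≥0∞) = min (g y) n := fun n y =>
    ENNReal.coe_toNNReal (ne_top_of_le_ne_top (ENNReal.natCast_ne_top n) (min_le_right _ _))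
  set f : ℕ → X → ℝ≥0 := fun n x => ⨅ y, (h n y + n * nndist x y) with hf
  have hle : ∀ n x y, f n x ≤ h n y + n * nndist x y := fun n x y => ciInf_le' _ y
  have hlex : ∀ n x, f n x ≤ h n x := fun n x => by simpa using hle n x x
  refine ⟨f, fun m n hmn x => ?_, fun n => ?_, fun n x => ?_, fun x => ?_⟩
  · have : Nonempty X := ⟨x⟩
    refine le_ciInf fun y => (hle m x y).trans ?_
    gcongr
    rw [← ENNReal.coe_le_coe, hcoe, hcoe]
    gcongr
  · refine (LipschitzWith.of_dist_le_mul (K := n) fun x x' => ?_).continuous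
    have key : ∀ x x', f n x ≤ f n x' + n * nndist x x' := fun x x' => by
      have : Nonempty X := ⟨x⟩
      rw [← tsub_le_iff_right]
      refine le_ciInf fun y => ?_
      rw [tsub_le_iff_right]
      refine (hle n x y).trans ?_
      rw [add_assoc, ← mul_add, add_comm (nndist x' y)]
      gcongr
      exact nndist_triangle _ _ _
    rw [NNReal.dist_eq, abs_sub_le_iff]
    have h1 : (f n x : ℝ) ≤ f n x' + n * dist x x' := by exact_mod_cast key x x'
    have h2 : (f n x' : ℝ) ≤ f n x + n * dist x' x := by exact_mod_cast key x' x
    rw [dist_comm] at h2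
    constructor <;> push_cast <;> linarith
  · refine (hlex n x).trans ?_
    rw [← ENNReal.coe_le_coe, hcoe]
    simp
  · refine le_antisymm (iSup_le fun n => ?_) ?_
    · refine (ENNReal.coe_le_coe.2 (hlex n x)).trans ?_
      rw [hcoe]
      exact min_le_left _ _
    · refine ENNReal.le_of_forall_nnreal_lt fun c hc => ?_
      have : Nonempty X := ⟨x⟩
      obtain ⟨δ, hδ, hball⟩ := Metric.eventually_nhds_iff.1 (hg x c hc)
      obtain ⟨n, hn⟩ := exists_nat_ge (max (c : ℝ) (c / δ))
      refine le_iSup_of_le n (ENNReal.coe_le_coe.2 (le_ciInf fun y => ?_))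
      rcases lt_or_ge (dist y x) δ with hy | hy
      · refine le_add_right ?_
        rw [← ENNReal.coe_le_coe, hcoe]
        refine le_min (hball hy).le ?_
        exact_mod_cast (le_max_left _ _).trans hn
      · refine le_add_left ?_
        rw [← NNReal.coe_le_coe]
        push_cast
        rw [dist_comm]
        calc (c : ℝ) = c / δ * δ := by field_simp
          _ ≤ n * dist y x := by
            gcongr
            exact (le_max_right _ _).trans hn

open scoped ENNReal NNReal in
lemma iSup_rpow_of_pos {ι : Sort*} (a : ι → ℝ≥0∞) {q : ℝ} (hq : 0 < q) :
    (⨆ i, a i) ^ q = ⨆ i, a i ^ q :=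
  (ENNReal.orderIsoRpow q hq).map_iSup a

open scoped ENNReal NNReal in
/-- Averages along a measurable choice of dilations: from continuous to lower semicontinuous
functions. -/
lemma lintegral_average_rpow_le_of_continuous {ν : Measure ℝ} [SFinite ν] {p q : ℝ} (hp : 0 < p)
    (hq : 0 < q) {r : ℝ → ℝ} (hr : Measurable r) {D : ℝ≥0∞ → ℝ≥0∞} (hD : Monotone D)
    (hb : ∀ f : ℝ → ℝ≥0, Continuous f → ∀ M : ℝ≥0, (∀ z, f z ≤ M) →
      ∫⁻ x, (∫⁻ y, f (x + r x * y) ∂ν) ^ q ≤ D (∫⁻ z, (f z : ℝ≥0∞) ^ p))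
    {g : ℝ → ℝ≥0∞} (hg : LowerSemicontinuous g) :
    ∫⁻ x, (∫⁻ y, g (x + r x * y) ∂ν) ^ q ≤ D (∫⁻ z, g z ^ p) := by
  obtain ⟨f, hfm, hfc, hfn, hfg⟩ := hg.exists_monotone_continuous_iSup_eq
  have hmono : ∀ z, Monotone fun n => (f n z : ℝ≥0∞) := fun z m n hmn =>
    ENNReal.coe_le_coe.2 (hfm hmn z)
  have hmeas : ∀ n, Measurable fun w : ℝ × ℝ => (f n (w.1 + r w.1 * w.2) : ℝ≥0∞) := fun n =>
    ((hfc n).measurable.comp (measurable_fst.add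
      ((hr.comp measurable_fst).mul measurable_snd))).coe_nnreal_ennreal
  have hsup : ∀ x, (∫⁻ y, g (x + r x * y) ∂ν) ^ q =
      ⨆ n, (∫⁻ y, f n (x + r x * y) ∂ν) ^ q := fun x => by
    simp only [← hfg]
    have hx : ∀ n, Measurable fun y => (f n (x + r x * y) : ℝ≥0∞) := fun n =>
      (hmeas n).comp measurable_prodMk_left
    rw [lintegral_iSup hx fun m n hmn y => hmono _ hmn, iSup_rpow_of_pos _ hq]
  simp only [hsup]
  rw [lintegral_iSup fun n => (hmeas n).lintegral_prod_right'.pow_const q]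
  · refine iSup_le fun n => (hb (f n) (hfc n) n (hfn n)).trans (hD (lintegral_mono fun z => ?_))
    rw [← hfg]
    gcongr
    exact le_iSup (fun n => (f n z : ℝ≥0∞)) n
  · intro m n hmn x
    refine ENNReal.rpow_le_rpow (lintegral_mono fun y => hmono _ hmn) hq.le

open scoped ENNReal in
/-- Linearization of a countable supremum by measurable choices. -/
lemma lintegral_iSup_rpow_le_of_measurable_choice {α β : Type*} [MeasurableSpace α]
    [MeasurableSpace β] {μ : Measure α} {t : ℕ → β} {φ : α → β → ℝ≥0∞}
    (hφ : ∀ i, Measurable fun x => φ x (t i)) {q : ℝ} (hq : 0 < q) {D : ℝ≥0∞}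
    (hb : ∀ r : α → β, Measurable r → (∀ x, r x ∈ range t) → ∫⁻ x, φ x (r x) ^ q ∂μ ≤ D) :
    ∫⁻ x, (⨆ i, φ x (t i)) ^ q ∂μ ≤ D := by
  classical
  have hm : ∀ n, Measurable fun x => partialSups (fun i => φ x (t i)) n := by
    intro n
    induction n with
    | zero => simpa using hφ 0
    | succ n ih =>
      simp only [partialSups_add_one]
      exact ih.sup (hφ _)
  have hchoice : ∀ n, ∃ r : α → β, Measurable r ∧ (∀ x, r x ∈ range t) ∧
      ∀ x, φ x (r x) = partialSups (fun i => φ x (t i)) n := by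
    intro n
    induction n with
    | zero => exact ⟨fun _ => t 0, measurable_const, fun _ => mem_range_self 0, fun x => by simp⟩
    | succ n ih =>
      obtain ⟨r, hr, hrt, hrφ⟩ := ih
      refine ⟨fun x => if φ x (t (n + 1)) ≤ partialSups (fun i => φ x (t i)) n then r x
        else t (n + 1), Measurable.ite (measurableSet_le (hφ _) (hm n)) hr measurable_const,
        fun x => ?_, fun x => ?_⟩
      · dsimp only
        split_ifs
        exacts [hrt x, mem_range_self _]
      · dsimp only
        rw [partialSups_add_one]
        split_ifs with h
        · rw [hrφ, sup_eq_left.2 h]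
        · rw [sup_eq_right.2 (not_le.1 h).le]
  have hsup : ∀ x, (⨆ i, φ x (t i)) ^ q = ⨆ n, partialSups (fun i => φ x (t i)) n ^ q := fun x => by
    rw [← iSup_partialSups_eq, iSup_rpow_of_pos _ hq]
  simp only [hsup]
  rw [lintegral_iSup]
  · refine iSup_le fun n => ?_
    obtain ⟨r, hr, hrt, hrφ⟩ := hchoice n
    simpa only [hrφ] using hb r hr hrt
  · exact fun n => (hm n).pow_const q
  · intro m n hmn x
    exact ENNReal.rpow_le_rpow ((partialSups _).monotone hmn) hq.le

open scoped ENNReal NNReal in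
lemma LowerSemicontinuous.lintegral_add_mul {ν : Measure ℝ} [IsFiniteMeasure ν] {g : ℝ → ℝ≥0∞}
    (hg : LowerSemicontinuous g) (x : ℝ) :
    LowerSemicontinuous fun t : ℝ => ∫⁻ y, g (x + t * y) ∂ν := by
  refine lowerSemicontinuous_iff_isClosed_preimage.2 fun c => ?_
  refine IsSeqClosed.isClosed fun u t hu hut => ?_
  have hgm : ∀ s, Measurable fun y => g (x + s * y) := fun s => hg.measurable.comp (by fun_prop)
  calc ∫⁻ y, g (x + t * y) ∂ν ≤ ∫⁻ y, liminf (fun n => g (x + u n * y)) atTop ∂ν := by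
        refine lintegral_mono fun y => ?_
        have hlim : Tendsto (fun n => x + u n * y) atTop (nhds (x + t * y)) :=
          (hut.mul_const y).const_add x
        exact (hg.le_liminf _).trans (hlim.liminf_le_liminf_comp)
    _ ≤ liminf (fun n => ∫⁻ y, g (x + u n * y) ∂ν) atTop := lintegral_liminf_le fun n => hgm _
    _ ≤ c := liminf_le_of_frequently_le' (Frequently.of_forall hu)

open scoped ENNReal in
lemma lintegral_iSup_average_rpow_le {ν : Measure ℝ} [IsFiniteMeasure ν] {q : ℝ} (hq : 0 < q)
    {g : ℝ → ℝ≥0∞} (hg : LowerSemicontinuous g) {D : ℝ≥0∞}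
    (hb : ∀ r : ℝ → ℝ, Measurable r → (∀ t, r t ∈ Icc (1 : ℝ) 2) →
      ∫⁻ x, (∫⁻ y, g (x + r x * y) ∂ν) ^ q ≤ D) :
    ∫⁻ x, (⨆ t : Icc (1 : ℝ) 2, ∫⁻ y, g (x + t * y) ∂ν) ^ q ≤ D := by
  have : Nonempty (Icc (1 : ℝ) 2) := ⟨⟨1, by norm_num⟩⟩
  set t : ℕ → Icc (1 : ℝ) 2 := TopologicalSpace.denseSeq _ with ht
  have hm : ∀ i, Measurable fun x => ∫⁻ y, g (x + (t i : ℝ) * y) ∂ν := fun i =>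
    Measurable.lintegral_prod_right' (f := fun w : ℝ × ℝ => g (w.1 + (t i : ℝ) * w.2))
      (hg.measurable.comp (by fun_prop))
  refine le_trans ?_ (lintegral_iSup_rpow_le_of_measurable_choice (t := t)
    (φ := fun x s => ∫⁻ y, g (x + (s : ℝ) * y) ∂ν) hm hq (D := D)
    fun r hr _ => hb (fun x => r x) (measurable_subtype_coe.comp hr) fun x => (r x).2)
  gcongr with x
  refine iSup_le fun s => (TopologicalSpace.denseRange_denseSeq (Icc (1 : ℝ) 2)).induction_on s ?_
    fun i => le_iSup (fun i => ∫⁻ y, g (x + (t i : ℝ) * y) ∂ν) i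
  exact ((hg.lintegral_add_mul (ν := ν) x).isClosed_preimage _).preimage continuous_subtype_val

lemma ofReal_iSup_le {ι : Sort*} [Nonempty ι] (a : ι → ℝ) :
    ENNReal.ofReal (⨆ i, a i) ≤ ⨆ i, ENNReal.ofReal (a i) := by
  rcases eq_or_ne (⨆ i, ENNReal.ofReal (a i)) ⊤ with h | h
  · rw [h]
    exact le_top
  · refine ENNReal.ofReal_le_of_le_toReal (ciSup_le fun i => ?_)
    exact (ENNReal.ofReal_le_iff_le_toReal h).1 (le_iSup (fun i => ENNReal.ofReal (a i)) i)

open scoped ENNReal in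
lemma enorm_restrictedMax_le (ν : Measure ℝ) {f : ℝ → ℝ} {G : ℝ → ℝ≥0∞}
    (hG : ∀ x, ‖f x‖ₑ ≤ G x) (x : ℝ) :
    ‖restrictedMax ν f x‖ₑ ≤ ⨆ t : Icc (1 : ℝ) 2, ∫⁻ y, G (x + t * y) ∂ν := by
  have : Nonempty (Icc (1 : ℝ) 2) := ⟨⟨1, by norm_num⟩⟩
  have h0 : ∀ t : Icc (1 : ℝ) 2, 0 ≤ ∫ y, |f (x + t * y)| ∂ν := fun t =>
    integral_nonneg fun y => abs_nonneg _
  rw [restrictedMax, Real.enorm_of_nonneg (Real.iSup_nonneg h0)]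
  refine (ofReal_iSup_le _).trans (iSup_mono fun t => ?_)
  rw [← Real.enorm_of_nonneg (h0 t)]
  refine (enorm_integral_le_lintegral_enorm _).trans (lintegral_mono fun y => ?_)
  simpa using hG _

open scoped ENNReal NNReal in
lemma eLpNorm_restrictedMax_le {ν : Measure ℝ} [IsFiniteMeasure ν] {p q : ℝ} (hp : 0 < p)
    (hq : 0 < q) {L : ℝ≥0}
    (hb : ∀ r : ℝ → ℝ, Measurable r → (∀ t, r t ∈ Icc (1 : ℝ) 2) →
      ∀ g : ℝ → ℝ≥0∞, LowerSemicontinuous g →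
        ∫⁻ x, (∫⁻ y, g (x + r x * y) ∂ν) ^ q ≤ L * (∫⁻ z, g z ^ p) ^ (q / p))
    {f : ℝ → ℝ} (hf : Measurable f) :
    eLpNorm (restrictedMax ν f) (ENNReal.ofReal q) volume ≤
      ((L ^ (1 / q) : ℝ≥0) : ℝ≥0∞) * eLpNorm f (ENNReal.ofReal p) volume := by
  set J := ∫⁻ x, ‖f x‖ₑ ^ p with hJ
  have key : ∀ ε : ℝ≥0∞, ε ≠ 0 →
      ∫⁻ x, ‖restrictedMax ν f x‖ₑ ^ q ≤ L * (J + ε) ^ (q / p) := by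
    intro ε hε
    obtain ⟨g, hfg, hg, hgJ⟩ := exists_le_lowerSemicontinuous_lintegral_ge volume
      (fun x => ‖f x‖ₑ ^ p) (hf.enorm.pow_const p) hε
    have hG : LowerSemicontinuous fun x => g x ^ (1 / p) :=
      ENNReal.continuous_rpow_const.comp_lowerSemicontinuous hg
        (ENNReal.monotone_rpow_of_nonneg (by positivity))
    have hfG : ∀ x, ‖f x‖ₑ ≤ g x ^ (1 / p) := fun x => by
      rw [one_div, ENNReal.le_rpow_inv_iff hp]
      exact hfg x
    calc ∫⁻ x, ‖restrictedMax ν f x‖ₑ ^ q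
        ≤ ∫⁻ x, (⨆ t : Icc (1 : ℝ) 2, ∫⁻ y, g (x + t * y) ^ (1 / p) ∂ν) ^ q := by
          gcongr with x
          exact enorm_restrictedMax_le ν hfG x
      _ ≤ L * (∫⁻ z, (g z ^ (1 / p)) ^ p) ^ (q / p) :=
          lintegral_iSup_average_rpow_le hq hG fun r hr hr12 => hb r hr hr12 _ hG
      _ ≤ L * (J + ε) ^ (q / p) := by
          gcongr
          simpa only [← ENNReal.rpow_mul, one_div_mul_cancel hp.ne', ENNReal.rpow_one] using hgJ
  have hlim : ∫⁻ x, ‖restrictedMax ν f x‖ₑ ^ q ≤ L * J ^ (q / p) := by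
    have h1 : Tendsto (fun n : ℕ => J + (n : ℝ≥0∞)⁻¹) atTop (nhds (J + 0)) :=
      tendsto_const_nhds.add ENNReal.tendsto_inv_nat_nhds_zero
    rw [add_zero] at h1
    refine ge_of_tendsto' (ENNReal.Tendsto.const_mul
      ((ENNReal.continuous_rpow_const.tendsto J).comp h1) (.inr ENNReal.coe_ne_top))
      fun n => key _ (by simp)
  have hq' : ENNReal.ofReal q ≠ 0 := by simpa using hq
  have hp' : ENNReal.ofReal p ≠ 0 := by simpa using hp
  rw [eLpNorm_eq_lintegral_rpow_enorm_toReal hq' (by simp),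
    eLpNorm_eq_lintegral_rpow_enorm_toReal hp' (by simp), ENNReal.toReal_ofReal hq.le,
    ENNReal.toReal_ofReal hp.le]
  calc (∫⁻ x, ‖restrictedMax ν f x‖ₑ ^ q) ^ (1 / q) ≤ (L * J ^ (q / p)) ^ (1 / q) := by gcongr
    _ = _ := by
        rw [ENNReal.mul_rpow_of_nonneg _ _ (by positivity), ← ENNReal.rpow_mul,
          ENNReal.coe_rpow_of_nonneg _ (by positivity)]
        congr 2
        field_simp

theorem stmt5
    (A : ℕ → Set ℝ)
    (hA_sub : ∀ n, A n ⊆ Icc 1 2)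
    (hA_dec : ∀ n, A (n + 1) ⊆ A n)
    (hA_int : ∀ n, ∃ (N : ℕ) (e : Fin N → ℝ × ℝ), A n = ⋃ i, Icc (e i).1 (e i).2)
    (hA_pos : ∀ n, 0 < volume (A n))
    (νn : ℕ → ℝ → ℝ)
    (hνn : ∀ n t, νn n t = ((volume (A n)).toReal)⁻¹ * (A n).indicator 1 t)
    (σ : ℕ → ℝ → ℝ)
    (hσ : ∀ n t, σ n t = νn (n + 1) t - νn n t)
    (ν : Measure ℝ) (hprob : IsProbabilityMeasure ν)
    (hweak : ∀ g : ℝ → ℝ, Continuous g → (∃ M, ∀ x, |g x| ≤ M) →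
      Tendsto (fun n => ∫ x, g x * νn n x) atTop (nhds (∫ x, g x ∂ν)))
    (d : ℕ) (hd2 : 2 ≤ d) (hdeven : Even d)
    (θ ξ K : ℝ) (hθ : 0 < θ) (hξ : 0 < ξ) (hK : 0 < K)
    (h1 : ∀ k : ℕ, 1 ≤ k → ∀ r : ℝ → ℝ, Measurable r → (∀ t, r t ∈ Icc (1 : ℝ) 2) →
      ∀ Ω : Set ℝ, MeasurableSet Ω → Ω ⊆ Icc 0 1 →
      (∫ x : Fin d → ℝ in univ.pi fun _ => Ω,
        ∫ z : ℝ, ∏ j, σ k ((z - x j) / r (x j))) ≤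
        K * Real.exp (-θ * k) * (volume Ω).toReal ^ (d - 1))
    (h2 : ∀ k : ℕ, 1 ≤ k → ∀ r : ℝ → ℝ, Measurable r → (∀ t, r t ∈ Icc (1 : ℝ) 2) →
      ∀ Ω : Set ℝ, MeasurableSet Ω → Ω ⊆ Icc 0 1 →
      (∫ x : Fin (d + 2) → ℝ in univ.pi fun _ => Ω,
        ∫ z : ℝ, ∏ j, σ k ((z - x j) / r (x j))) ≤
        K * Real.exp (ξ * k) * (volume Ω).toReal ^ (d + 1))
    (p₀ : ℝ)
    (hp₀ : p₀ = ((2 + (d : ℝ)) * θ + (d : ℝ) * ξ) /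
      ((1 + (d : ℝ)) * θ + ((d : ℝ) - 1) * ξ)) :
    ∀ p q : ℝ, p₀ < p → p ≤ q → q ≤ p / (p₀ - 1) →
      ∃ C : ℝ, 0 ≤ C ∧ ∀ f : ℝ → ℝ, Measurable f →
        eLpNorm (restrictedMax ν f) (ENNReal.ofReal q) volume ≤
          ENNReal.ofReal C * eLpNorm f (ENNReal.ofReal p) volume := by
  intro p q hp hpq hq
  have hdR : (2 : ℝ) ≤ d := by exact_mod_cast hd2
  set num := (2 + (d : ℝ)) * θ + (d : ℝ) * ξ with hnum
  set den := (1 + (d : ℝ)) * θ + ((d : ℝ) - 1) * ξ with hden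
  have hden0 : 0 < den := by
    have : 0 < ((d : ℝ) - 1) * ξ := mul_pos (by linarith) hξ
    positivity
  have hnum0 : 0 < num := by positivity
  have hp₀1 : 1 < p₀ := by
    rw [hp₀, one_lt_div hden0]
    linarith
  have hp₀2 : p₀ ≤ 2 := by
    rw [hp₀, div_le_iff₀ hden0]
    have : 0 ≤ ((d : ℝ) - 2) * ξ := mul_nonneg (by linarith) hξ.le
    have : 0 < (d : ℝ) * θ := by positivity
    linarith
  have hp₀0 : 0 < p₀ := by linarith
  have hp0 : 0 < p := by linarith
  have hq0 : 0 < q := by linarith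
  set γ := p₀⁻¹ with hγ
  have hγnum : γ * num = den := by
    rw [hγ, hp₀]
    field_simp
  have hγ1 : γ < 1 := inv_lt_one_of_one_lt₀ hp₀1
  have hγ0 : 1 / 2 ≤ γ := by
    rw [one_div]
    exact inv_anti₀ hp₀0 hp₀2
  have hκ : p * (γ / (1 - γ)) = p / (p₀ - 1) := by
    have : p₀ - 1 ≠ 0 := by linarith
    have : 1 - γ ≠ 0 := by linarith
    rw [div_eq_mul_inv p]
    congr 1
    rw [div_eq_iff this, hγ]
    field_simp
  have hqκ : q ≤ p * (γ / (1 - γ)) := hκ ▸ hq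
  have hp₁γ : 1 < (p + p₀) / 2 * γ := by
    rw [hγ, ← div_eq_mul_inv, one_lt_div hp₀0]
    linarith
  have hAm : ∀ n, MeasurableSet (A n) := fun n => by
    obtain ⟨N, e, he⟩ := hA_int n
    rw [he]
    exact .iUnion fun i => measurableSet_Icc
  have hAt : ∀ n, volume (A n) ≠ ⊤ := fun n => measure_ne_top_of_subset (hA_sub n) (by simp)
  have hV : ∀ n, 0 < (volume (A n)).toReal := fun n =>
    ENNReal.toReal_pos (hA_pos n).ne' (hAt n)
  have hνeq : ∀ n, νn n = (A n).indicator fun _ => ((volume (A n)).toReal)⁻¹ := fun n => by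
    ext t
    rw [hνn]
    by_cases ht : t ∈ A n <;> simp [ht]
  have hνm : ∀ n, Measurable (νn n) := fun n => by
    rw [hνeq]
    exact measurable_const.indicator (hAm n)
  have hν0 : ∀ n t, 0 ≤ νn n t := fun n t => by
    rw [hνeq]
    exact indicator_nonneg (fun _ _ => (inv_pos.2 (hV n)).le) t
  have hνB : ∀ n t, νn n t ≤ ((volume (A n)).toReal)⁻¹ := fun n t => by
    rw [hνeq]
    exact indicator_le_self' (fun _ _ => (inv_pos.2 (hV n)).le) t
  have hνabs : ∀ n t, |νn n t| ≤ ((volume (A n)).toReal)⁻¹ := fun n t => by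
    rw [abs_of_nonneg (hν0 n t)]
    exact hνB n t
  have hνs : ∀ n t, t ∉ Icc (1 : ℝ) 2 → νn n t = 0 := fun n t ht => by
    rw [hνeq]
    exact indicator_of_notMem (fun h => ht (hA_sub n h)) _
  have hνi : ∀ n, Integrable (νn n) := fun n => by
    rw [hνeq]
    exact (integrableOn_const (hAt n)).integrable_indicator (hAm n)
  have hν1 : ∀ n, ∫⁻ t, ENNReal.ofReal (νn n t) ≤ 1 := fun n => by
    rw [← ofReal_integral_eq_lintegral_ofReal (hνi n) (Eventually.of_forall (hν0 n)), hνeq,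
      integral_indicator_const _ (hAm n), measureReal_def, smul_eq_mul,
      mul_inv_cancel₀ (hV n).ne', ENNReal.ofReal_one]
  obtain ⟨C, hC0, hC⟩ := exists_restricted_bound hνm hνabs hνs hσ hd2 hdeven hθ hξ hK h1 h2 hγnum
  obtain ⟨C', hC'⟩ := exists_lintegral_average_rpow_le hγ0 hγ1 hp₁γ
    (p := p) (by linarith) hC0
  have hloc : ∀ r : ℝ → ℝ, Measurable r → (∀ t, r t ∈ Icc (1 : ℝ) 2) →
      ∀ f : ℝ → NNReal, Continuous f → ∀ M : NNReal, (∀ z, f z ≤ M) →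
        ∫⁻ x in Icc 0 1, (∫⁻ y, f (x + r x * y) ∂ν) ^ (p * (γ / (1 - γ))) ≤
          C' * (∫⁻ z in Icc 1 5, (f z : ENNReal) ^ p) ^ (γ / (1 - γ)) :=
    fun r hr hr12 f hf M hM => lintegral_average_rpow_le_of_weak hνm hνi hν0 hweak hf hM hr
      fun n => hC' _ _ (hνm _) (hν0 _) (hνB _) (hνs _) (hν1 _) r hr hr12 (hC n r hr hr12) f
        hf.measurable M hM
  refine ⟨((C' ^ (q / (p * (γ / (1 - γ)))) * 5 ^ (q / p)) ^ (1 / q) : NNReal), NNReal.coe_nonneg _,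
    fun f hf => ?_⟩
  rw [ENNReal.ofReal_coe_nnreal]
  refine eLpNorm_restrictedMax_le hp0 hq0 (fun r hr hr12 g hg => ?_) hf
  refine lintegral_average_rpow_le_of_continuous hp0 hq0 hr
    (D := fun a => ((C' ^ (q / (p * (γ / (1 - γ)))) * 5 ^ (q / p) : NNReal) : ENNReal) *
      a ^ (q / p)) (fun a b hab => ?_) (fun f hf M hM => ?_) hg
  · dsimp only
    gcongr
  · refine (lintegral_average_rpow_le_of_local hp0 hpq hqκ hloc hr hr12 hf hM).trans (le_of_eq ?_)
    rw [ENNReal.mul_rpow_of_nonneg _ _ (by positivity), ← mul_assoc, ENNReal.coe_mul,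
      ENNReal.coe_rpow_of_nonneg _ (div_nonneg hq0.le (hq0.trans_le hqκ).le),
      ENNReal.coe_rpow_of_nonneg _ (by positivity), ENNReal.coe_ofNat]
end

section
/- Let ν be a Borel probability measure on ℝ with compact support A, and suppose there exist p, q ∈ [1,∞) and C < ∞ such that ‖M_ν f‖_{L^q(ℝ)} ≤ C‖f‖_{L^p(ℝ)} for every measurable f: ℝ → [0,∞). Let E ⊂ ℝ be a Borel set and let F ⊂ ℝ be a set of positive Lebesgue measure such that for every x ∈ F there exists r = r(x) ∈ [1,2] with x + rA ⊂ E. Then E has positive Lebesgue measure. -/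
open MeasureTheory Set

/-- The (topological) support of a measure on `ℝ`. -/
def msupport (ν : Measure ℝ) : Set ℝ :=
  {x | ∀ ε > 0, 0 < ν (Metric.ball x ε)}

theorem measure_compl_msupport (ν : Measure ℝ) : ν (msupport ν)ᶜ = 0 := by
  refine measure_null_of_locally_null _ fun x hx => ?_
  simp only [msupport, mem_compl_iff, mem_ofPred_eq, not_forall, not_lt, nonpos_iff_eq_zero] at hx
  obtain ⟨ε, hε, h⟩ := hx
  exact ⟨_, mem_nhdsWithin_of_mem_nhds (Metric.ball_mem_nhds x hε), h⟩

theorem isOpen_setOf_exists_add_mul_mem {A U R : Set ℝ} (hA : IsCompact A) (hU : IsOpen U) :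
    IsOpen {x : ℝ | ∃ r ∈ R, ∀ a ∈ A, x + r * a ∈ U} := by
  rw [isOpen_iff_eventually]
  rintro x ⟨r, hr, h⟩
  have : ∀ᶠ z in nhds x, ∀ a ∈ A, z + r * a ∈ U := by
    refine hA.eventually_forall_of_forall_eventually fun a ha => ?_
    have hc : Continuous fun z : ℝ × ℝ => z.1 + r * z.2 := by fun_prop
    exact hc.continuousAt.eventually (hU.mem_nhds (h a ha))
  exact this.mono fun z hz => ⟨r, hr, hz⟩

theorem one_le_restrictedMax_indicator (ν : Measure ℝ) [IsProbabilityMeasure ν] {U : Set ℝ}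
    {x r : ℝ} (hr : r ∈ Icc (1 : ℝ) 2) (h : ∀ a ∈ msupport ν, x + r * a ∈ U) :
    1 ≤ restrictedMax ν (U.indicator fun _ => 1) x := by
  have habs (z : ℝ) : |U.indicator (fun _ => (1 : ℝ)) z| ≤ 1 := by
    by_cases hz : z ∈ U <;> simp [hz]
  have hbdd : BddAbove (range fun s : Icc (1 : ℝ) 2 =>
      ∫ y, |U.indicator (fun _ => (1 : ℝ)) (x + (s : ℝ) * y)| ∂ν) := by
    refine ⟨1, ?_⟩
    rintro _ ⟨s, rfl⟩
    have := integral_mono_of_nonneg (μ := ν)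
      (f := fun y => |U.indicator (fun _ => (1 : ℝ)) (x + (s : ℝ) * y)|) (g := fun _ => (1 : ℝ))
      (.of_forall fun y => abs_nonneg _) (integrable_const _) (.of_forall fun y => habs _)
    simpa using this
  refine le_trans (le_of_eq ?_) (le_ciSup hbdd ⟨r, hr⟩)
  have hae : (fun y => |U.indicator (fun _ => (1 : ℝ)) (x + r * y)|) =ᵐ[ν] fun _ => 1 := by
    filter_upwards [mem_ae_iff.2 (measure_compl_msupport ν)] with y hy
    simp [h y hy]
  rw [integral_congr_ae hae]
  simp

theorem stmt8 (ν : Measure ℝ) [IsProbabilityMeasure ν]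
    (A : Set ℝ) (hA : IsCompact A) (hsupp : msupport ν = A)
    (p q : ℝ) (hp : 1 ≤ p) (hq : 1 ≤ q) (C : ℝ)
    (hC : ∀ f : ℝ → ℝ, Measurable f → (∀ x, 0 ≤ f x) →
      eLpNorm (restrictedMax ν f) (ENNReal.ofReal q) volume ≤
        ENNReal.ofReal C * eLpNorm f (ENNReal.ofReal p) volume)
    (E : Set ℝ) (hE : MeasurableSet E)
    (F : Set ℝ) (hF : 0 < volume F)
    (hFE : ∀ x ∈ F, ∃ r ∈ Icc (1 : ℝ) 2, (fun a => x + r * a) '' A ⊆ E) :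
    0 < volume E := by
  have hp0 : 0 < p := by linarith
  have hq0 : 0 < q := by linarith
  by_contra hE0
  replace hE0 : volume E = 0 := by simpa using hE0
  have key : ∀ ε : ENNReal, 0 < ε →
      volume F ^ (1 / q) ≤ ENNReal.ofReal C * ε ^ (1 / p) := by
    intro ε hε
    obtain ⟨U, hEU, hU, hUε⟩ := E.exists_isOpen_lt_of_lt ε (hE0 ▸ hε)
    set G : Set ℝ := {x | ∃ r ∈ Icc (1 : ℝ) 2, ∀ a ∈ A, x + r * a ∈ U}
    have hG : MeasurableSet G := (isOpen_setOf_exists_add_mul_mem hA hU).measurableSet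
    have hFG : F ⊆ G := fun x hx =>
      let ⟨r, hr, h⟩ := hFE x hx
      ⟨r, hr, fun a ha => hEU (h ⟨a, ha, rfl⟩)⟩
    have hnorm (S : Set ℝ) (hS : MeasurableSet S) (s : ℝ) (hs : 0 < s) :
        eLpNorm (S.indicator fun _ => (1 : ℝ)) (ENNReal.ofReal s) volume
          = volume S ^ (1 / s) := by
      rw [eLpNorm_indicator_const hS (by simpa using hs) ENNReal.ofReal_ne_top,
        ENNReal.toReal_ofReal hs.le]
      simp
    calc volume F ^ (1 / q) ≤ volume G ^ (1 / q) := by gcongr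
      _ = eLpNorm (G.indicator fun _ => (1 : ℝ)) (ENNReal.ofReal q) volume :=
        (hnorm G hG q hq0).symm
      _ ≤ eLpNorm (restrictedMax ν (U.indicator fun _ => 1)) (ENNReal.ofReal q) volume := by
        refine eLpNorm_mono fun x => ?_
        by_cases hx : x ∈ G
        · obtain ⟨r, hr, h⟩ := id hx
          have h1 := one_le_restrictedMax_indicator ν hr (hsupp ▸ h)
          rw [indicator_of_mem hx, norm_one]
          exact h1.trans (Real.le_norm_self _)
        · simp [hx]
      _ ≤ ENNReal.ofReal C *
          eLpNorm (U.indicator fun _ => (1 : ℝ)) (ENNReal.ofReal p) volume :=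
        hC _ (measurable_const.indicator hU.measurableSet)
          fun x => indicator_nonneg (fun _ _ => zero_le_one) x
      _ = ENNReal.ofReal C * volume U ^ (1 / p) := by rw [hnorm U hU.measurableSet p hp0]
      _ ≤ ENNReal.ofReal C * ε ^ (1 / p) := by gcongr
  have hlim : Filter.Tendsto (fun ε : ENNReal => ENNReal.ofReal C * ε ^ (1 / p))
      (nhdsWithin 0 (Ioi 0)) (nhds 0) := by
    have h1 : Filter.Tendsto (fun ε : ENNReal => ε ^ (1 / p)) (nhds 0) (nhds 0) := by
      simpa [hp0] using (ENNReal.continuous_rpow_const (y := 1 / p)).tendsto 0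
    simpa using (ENNReal.Tendsto.const_mul h1 (.inr ENNReal.ofReal_ne_top)).mono_left
      nhdsWithin_le_nhds
  have hle : volume F ^ (1 / q) ≤ 0 :=
    ge_of_tendsto hlim (Filter.mem_of_superset self_mem_nhdsWithin key)
  have hpos : 0 < 1 / q := by positivity
  rw [nonpos_iff_eq_zero, ENNReal.rpow_eq_zero_iff_of_pos hpos] at hle
  exact hF.ne' hle
end

section
/- Let s ∈ (0,1), let m, β be positive integers with 2^{sm−1} < β ≤ 2^{sm}, let A ⊂ [1,2] be a union of β pairwise non-overlapping closed dyadic intervals of length 2^{−m}, and let ν_m be the function (2^m/β) 1_{A}. Then there is a constant C depending only on d such that for every integer d ≥ 1, every x ∈ ℝ^d and every r ∈ [1,2]^d, ∫_{L_{x,r}} ∏_{i=1}^d ν_m(y_i) dℋ¹(y) ≤ C · 2^{m(d−1)(1−s)}. -/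
open MeasureTheory Set

/-- The line `L_{x,r} = {((z-x_1)/r_1, …, (z-x_d)/r_d) : z ∈ ℝ} ⊂ ℝ^d`. -/
def line (d : ℕ) (x r : Fin d → ℝ) : Set (EuclideanSpace ℝ (Fin d)) :=
  {y | ∃ z : ℝ, ∀ i, y i = (z - x i) / r i}

/-- The part of `L_{x,r}` whose `i`-th coordinate lies in `A` is a Lipschitz image of `A`. -/
theorem hausdorffMeasure_line_inter_le (d : ℕ) (i₀ : Fin d) (x r : Fin d → ℝ)
    (hr : ∀ i, r i ∈ Icc (1 : ℝ) 2) (A : Set ℝ) :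
    μH[1] (line d x r ∩ {y | y i₀ ∈ A}) ≤ ((2 * d : NNReal) : ENNReal) * volume A := by
  let g : ℝ → EuclideanSpace ℝ (Fin d) :=
    fun t => WithLp.toLp 2 fun i => (r i₀ * t + x i₀ - x i) / r i
  have hr_pos : ∀ i, 0 < r i := fun i => lt_of_lt_of_le one_pos (hr i).1
  have hg : LipschitzWith (2 * d : NNReal) g := by
    refine LipschitzWith.of_dist_le_mul fun t u => ?_
    rw [EuclideanSpace.dist_eq]
    refine Real.sqrt_le_iff.2 ⟨by positivity, ?_⟩
    have hcoord : ∀ i, dist (g t i) (g u i) ^ 2 ≤ (2 * dist t u) ^ 2 := by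
      intro i
      refine pow_le_pow_left₀ dist_nonneg ?_ 2
      have heq : g t i - g u i = r i₀ / r i * (t - u) := by
        simp only [g]
        field_simp [(hr_pos i).ne']
        ring
      rw [Real.dist_eq, Real.dist_eq, heq, abs_mul,
        abs_of_pos (div_pos (hr_pos i₀) (hr_pos i))]
      refine mul_le_mul_of_nonneg_right ?_ (abs_nonneg _)
      rw [div_le_iff₀ (hr_pos i)]
      linarith [(hr i₀).2, (hr i).1]
    have hd : (1 : ℝ) ≤ d := by exact_mod_cast i₀.pos
    calc ∑ i, dist (g t i) (g u i) ^ 2 ≤ ∑ _i : Fin d, (2 * dist t u) ^ 2 :=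
          Finset.sum_le_sum fun i _ => hcoord i
      _ = d * (2 * dist t u) ^ 2 := by simp
      _ ≤ d ^ 2 * (2 * dist t u) ^ 2 := by gcongr; nlinarith
      _ = (((2 * d : NNReal) : ℝ) * dist t u) ^ 2 := by push_cast; ring
  have hsub : line d x r ∩ {y | y i₀ ∈ A} ⊆ g '' A := by
    rintro y ⟨⟨z, hz⟩, hy⟩
    refine ⟨y i₀, hy, ?_⟩
    ext i
    simp only [g, hz]
    field_simp [(hr_pos i₀).ne', (hr_pos i).ne']
    ring
  calc μH[1] (line d x r ∩ {y | y i₀ ∈ A}) ≤ μH[1] (g '' A) := measure_mono hsub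
    _ ≤ ((2 * d : NNReal) : ENNReal) ^ (1 : ℝ) * μH[1] A :=
        hg.hausdorffMeasure_image_le zero_le_one A
    _ = ((2 * d : NNReal) : ENNReal) * volume A := by
        rw [ENNReal.rpow_one, hausdorffMeasure_real]

theorem volume_biUnion_dyadic_le (m : ℕ) (S : Finset ℤ) :
    volume (⋃ j ∈ S, Icc ((j : ℝ) / 2 ^ m) (((j : ℝ) + 1) / 2 ^ m)) ≤
      ENNReal.ofReal (S.card / 2 ^ m) := by
  refine (measure_biUnion_finset_le S _).trans ?_
  have hlen : ∀ j : ℤ, ((j : ℝ) + 1) / 2 ^ m - (j : ℝ) / 2 ^ m = 1 / 2 ^ m := fun j => by ring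
  simp only [Real.volume_Icc, hlen, Finset.sum_const, nsmul_eq_mul]
  rw [div_eq_mul_one_div (S.card : ℝ), ENNReal.ofReal_mul (by positivity), ENNReal.ofReal_natCast]

theorem stmt11 (d : ℕ) (hd : 1 ≤ d) :
    ∃ C : ℝ, 0 < C ∧
    ∀ s : ℝ, s ∈ Ioo (0 : ℝ) 1 →
    ∀ m β : ℕ, 1 ≤ m → 1 ≤ β →
      (2 : ℝ) ^ (s * (m : ℝ) - 1) < β → (β : ℝ) ≤ 2 ^ (s * (m : ℝ)) →
    ∀ S : Finset ℤ, S.card = β →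
    ∀ A : Set ℝ, A = ⋃ j ∈ S, Icc ((j : ℝ) / 2 ^ m) (((j : ℝ) + 1) / 2 ^ m) →
      A ⊆ Icc 1 2 →
    ∀ x r : Fin d → ℝ, (∀ i, r i ∈ Icc (1 : ℝ) 2) →
      (∫ y in line d x r, ∏ i, (2 ^ m / (β : ℝ)) * A.indicator 1 (y i) ∂μH[1]) ≤
        C * 2 ^ ((m : ℝ) * ((d : ℝ) - 1) * (1 - s)) := by
  obtain ⟨n, rfl⟩ : ∃ n, d = n + 1 := ⟨d - 1, by omega⟩
  refine ⟨2 * ((n + 1 : ℕ) : ℝ) * 2 ^ n, by positivity, ?_⟩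
  intro s _ m β _ hβ hlow _ S hS A hA _ x r hr
  set c : ℝ := 2 ^ m / (β : ℝ) with hc
  have hβ_pos : (0 : ℝ) < β := by exact_mod_cast hβ
  have hc_pos : 0 < c := by positivity
  have hA_meas : MeasurableSet A := by
    rw [hA]
    exact S.measurableSet_biUnion fun _ _ => measurableSet_Icc
  let T : Set (EuclideanSpace ℝ (Fin (n + 1))) := {y | y 0 ∈ A}
  have hT : MeasurableSet T := by
    have : Measurable fun y : EuclideanSpace ℝ (Fin (n + 1)) => y 0 := by fun_prop
    exact this hA_meas
  let f : EuclideanSpace ℝ (Fin (n + 1)) → ℝ := fun y => ∏ i, c * A.indicator 1 (y i)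
  have hf_ind : T.indicator f = f := by
    refine indicator_eq_self.2 fun y hy => ?_
    by_contra hy0
    refine hy (Finset.prod_eq_zero (Finset.mem_univ 0) ?_)
    rw [indicator_of_notMem (show y 0 ∉ A from hy0), mul_zero]
  have hf_norm : ∀ y, ‖f y‖ ≤ c ^ (n + 1) := by
    intro y
    rw [Real.norm_eq_abs, Finset.abs_prod]
    refine (Finset.prod_le_prod (g := fun _ => c) (fun _ _ => abs_nonneg _)
      fun i _ => ?_).trans_eq (by simp)
    by_cases hi : y i ∈ A <;> simp [hi, abs_of_pos hc_pos, hc_pos.le]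
  have hμ : μH[1] (line (n + 1) x r ∩ T) ≤
      ENNReal.ofReal (2 * ((n + 1 : ℕ) : ℝ) * (β / 2 ^ m)) := by
    refine (hausdorffMeasure_line_inter_le (n + 1) 0 x r hr A).trans ?_
    rw [ENNReal.ofReal_mul (by positivity)]
    refine mul_le_mul' (le_of_eq ?_) ?_
    · rw [← ENNReal.ofReal_coe_nnreal]
      push_cast
      rfl
    · rw [hA, ← hS]
      exact volume_biUnion_dyadic_le m S
  have hc_le : c ≤ 2 * 2 ^ ((m : ℝ) * (1 - s)) := by
    rw [hc, div_le_iff₀ hβ_pos]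
    calc (2 : ℝ) ^ m = 2 * 2 ^ ((m : ℝ) * (1 - s)) * 2 ^ (s * (m : ℝ) - 1) := by
          rw [mul_assoc, ← Real.rpow_add two_pos,
            show (m : ℝ) * (1 - s) + (s * m - 1) = m - 1 by ring,
            Real.rpow_sub_one two_ne_zero, Real.rpow_natCast]
          ring
      _ ≤ _ := by gcongr
  calc ∫ y in line (n + 1) x r, f y ∂μH[1] = ∫ y in line (n + 1) x r ∩ T, f y ∂μH[1] := by
        rw [← setIntegral_indicator hT, hf_ind]
    _ ≤ ‖∫ y in line (n + 1) x r ∩ T, f y ∂μH[1]‖ := Real.le_norm_self _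
    _ ≤ c ^ (n + 1) * (μH[1]).real (line (n + 1) x r ∩ T) :=
        norm_setIntegral_le_of_norm_le_const (hμ.trans_lt ENNReal.ofReal_lt_top)
          fun y _ => hf_norm y
    _ ≤ c ^ (n + 1) * (2 * ((n + 1 : ℕ) : ℝ) * (β / 2 ^ m)) := by
        gcongr
        exact ENNReal.toReal_le_of_le_ofReal (by positivity) hμ
    _ = 2 * ((n + 1 : ℕ) : ℝ) * c ^ n := by
        rw [hc, pow_succ]
        field_simp
    _ ≤ 2 * ((n + 1 : ℕ) : ℝ) * (2 * 2 ^ ((m : ℝ) * (1 - s))) ^ n := by gcongr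
    _ = 2 * ((n + 1 : ℕ) : ℝ) * 2 ^ n *
          2 ^ ((m : ℝ) * (((n + 1 : ℕ) : ℝ) - 1) * (1 - s)) := by
        rw [mul_pow, ← Real.rpow_mul_natCast two_pos.le, mul_assoc]
        push_cast
        ring_nf
end

section
/- Let s ∈ (0,1), let d ≥ 2 be an integer, let B ≥ 1, and let m ≤ k be positive integers. Let f: ℝ → [0,∞) be a measurable function vanishing outside [1,2] such that f(y) ≤ B·2^{k(1−s)} for all y and ∫_I f(y) dy ≤ B|I|^s for every interval I ⊂ ℝ. Then there is a constant C depending only on d and s such that for every x ∈ [−4,0]^d with min_{i≠j}|x_i − x_j| > 4·2^{−m} and every r ∈ [1,2]^d, ∫_{L_{x,r} ∩ Δ(2^{−k})} ∏_{i=1}^d f(y_i) dℋ¹(y) ≤ C B^d 2^{ms + k(d−1−ds)}. -/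
open MeasureTheory Set

/-- The union of the diagonals `Δ = {y : y_i = y_j for some i ≠ j}`. -/
def diag (d : ℕ) : Set (EuclideanSpace ℝ (Fin d)) :=
  {y | ∃ i j, i ≠ j ∧ y i = y j}

/-- The affine parametrization of `line d x r` by `z`. -/
noncomputable def lineParam (d : ℕ) (x r : Fin d → ℝ) (z : ℝ) : EuclideanSpace ℝ (Fin d) :=
  WithLp.toLp 2 fun i => (z - x i) / r i

lemma line_eq_range_lineParam (d : ℕ) (x r : Fin d → ℝ) : line d x r = range (lineParam d x r) := by
  ext y
  constructor
  · rintro ⟨z, hz⟩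
    refine ⟨z, ?_⟩
    ext i
    simp [lineParam, hz]
  · rintro ⟨z, rfl⟩
    exact ⟨z, fun i => rfl⟩

lemma lipschitzWith_lineParam (d : ℕ) (x r : Fin d → ℝ) (hr : ∀ i, 1 ≤ r i) :
    LipschitzWith d (lineParam d x r) := by
  refine LipschitzWith.of_dist_le_mul fun z w => ?_
  rw [EuclideanSpace.dist_eq]
  have hterm : ∀ i, dist (lineParam d x r z i) (lineParam d x r w i) ≤ dist z w := by
    intro i
    have hri : 0 < r i := by linarith [hr i]
    have : (z - x i) / r i - (w - x i) / r i = (z - w) / r i := by ring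
    simp only [lineParam, Real.dist_eq]
    rw [this, abs_div, abs_of_pos hri]
    exact div_le_self (abs_nonneg _) (hr i)
  refine Real.sqrt_le_iff.2 ⟨by positivity, ?_⟩
  calc ∑ i, dist (lineParam d x r z i) (lineParam d x r w i) ^ 2
      ≤ ∑ _i : Fin d, dist z w ^ 2 := by
        gcongr with i
        exact hterm i
    _ = d * dist z w ^ 2 := by simp
    _ ≤ (d * dist z w) ^ 2 := by
        rw [mul_pow]
        gcongr
        exact_mod_cast Nat.le_self_pow (by norm_num) d

lemma setLIntegral_line_inter_le (d : ℕ) (x r : Fin d → ℝ) (hr : ∀ i, 1 ≤ r i)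
    {S : Set (EuclideanSpace ℝ (Fin d))} (hS : MeasurableSet S)
    {g : EuclideanSpace ℝ (Fin d) → ENNReal} (hg : Measurable g) :
    ∫⁻ y in line d x r ∩ S, g y ∂μH[1] ≤
      d * ∫⁻ z in lineParam d x r ⁻¹' S, g (lineParam d x r z) := by
  have hL := lipschitzWith_lineParam d x r hr
  have hm : Measurable (lineParam d x r) := hL.continuous.measurable
  have hle : (μH[1]).restrict (line d x r) ≤
      (d : ENNReal) • (volume : Measure ℝ).map (lineParam d x r) := by
    refine Measure.le_iff.2 fun A hA => ?_
    rw [Measure.restrict_apply hA, Measure.smul_apply, Measure.map_apply hm hA,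
      line_eq_range_lineParam, ← image_preimage_eq_inter_range]
    have := hL.hausdorffMeasure_image_le zero_le_one (lineParam d x r ⁻¹' A)
    simpa [hausdorffMeasure_real] using this
  rw [inter_comm, ← Measure.restrict_restrict hS]
  calc ∫⁻ y in S, g y ∂((μH[1]).restrict (line d x r))
      ≤ ∫⁻ y in S, g y ∂((d : ENNReal) • (volume : Measure ℝ).map (lineParam d x r)) :=
        lintegral_mono' (Measure.restrict_mono le_rfl hle) le_rfl
    _ = d * ∫⁻ z in lineParam d x r ⁻¹' S, g (lineParam d x r z) := by
        rw [Measure.restrict_smul, lintegral_smul_measure, setLIntegral_map hS hg hm, smul_eq_mul]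

lemma exists_abs_sub_le_of_mem_cthickening_diag {d : ℕ} {δ : ℝ} (hδ : 0 < δ)
    {y : EuclideanSpace ℝ (Fin d)} (hy : y ∈ Metric.cthickening δ (diag d)) :
    ∃ i j, i ≠ j ∧ |y i - y j| ≤ 3 / 2 * δ := by
  have hy' := Metric.cthickening_subset_thickening' (δ₂ := 21 / 20 * δ) (by positivity)
    (by linarith) (diag d) hy
  obtain ⟨p, ⟨i, j, hij, hp⟩, hd⟩ := Metric.mem_thickening_iff.1 hy'
  refine ⟨i, j, hij, ?_⟩
  rw [EuclideanSpace.dist_eq, Real.sqrt_lt' (by positivity)] at hd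
  have hpair : ∑ l ∈ {i, j}, dist (y l) (p l) ^ 2 ≤ ∑ l, dist (y l) (p l) ^ 2 :=
    Finset.sum_le_sum_of_subset_of_nonneg (Finset.subset_univ _) fun _ _ _ => by positivity
  rw [Finset.sum_pair hij, Real.dist_eq, Real.dist_eq, sq_abs, sq_abs] at hpair
  refine abs_le_of_sq_le_sq ?_ (by positivity)
  have : y i - y j = (y i - p i) - (y j - p j) := by rw [hp]; ring
  rw [this]
  nlinarith [sq_nonneg ((y i - p i) + (y j - p j)), sq_nonneg δ]

/-- The parameters of the points of a line lying near a diagonal form a set of small diameter. -/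
lemma abs_sub_le_of_near_diag {a b p q δ η z w : ℝ} (hη : 0 < η) (hδη : δ ≤ η)
    (hp : p ∈ Icc (1 : ℝ) 2) (hq : q ∈ Icc (1 : ℝ) 2) (hab : 4 * η < |a - b|)
    (hz : |(z - a) / p - (z - b) / q| ≤ 3 / 2 * δ) (hz1 : (z - a) / p ∈ Icc (1 : ℝ) 2)
    (hw : |(w - a) / p - (w - b) / q| ≤ 3 / 2 * δ) :
    |z - w| ≤ 24 * (δ / η) := by
  obtain ⟨hp1, hp2⟩ := hp
  obtain ⟨hq1, hq2⟩ := hq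
  have hp0 : 0 < p := by linarith
  have hq0 : 0 < q := by linarith
  set u := (z - a) / p with hu
  set v := (z - b) / q with hv
  have hpu : p * u = z - a := by rw [hu]; field_simp
  have hqv : q * v = z - b := by rw [hv]; field_simp
  have hkey : a - b = (q - p) * u - q * (u - v) := by linear_combination hpu - hqv
  have h1 : |a - b| ≤ |q - p| * 2 + 2 * (3 / 2 * δ) := by
    rw [hkey]
    refine (abs_sub _ _).trans ?_
    rw [abs_mul, abs_mul, abs_of_pos hq0, abs_of_pos (by linarith [hz1.1] : 0 < u)]
    gcongr
    exact hz1.2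
  have hslope : η / 2 ≤ |q - p| := by linarith
  have h2 : (z - w) * (q - p) = p * q * ((u - v) - ((w - a) / p - (w - b) / q)) := by
    rw [hu, hv]; field_simp; ring
  have h3 : |z - w| * |q - p| ≤ 2 * 2 * (3 / 2 * δ + 3 / 2 * δ) := by
    rw [← abs_mul, h2, abs_mul, abs_of_pos (mul_pos hp0 hq0)]
    gcongr
    exact (abs_sub _ _).trans (add_le_add hz hw)
  have h4 : |z - w| * (η / 2) ≤ |z - w| * |q - p| := by gcongr
  rw [← mul_div_assoc, le_div_iff₀ hη]
  linarith

lemma setLIntegral_comp_affine_le {f : ℝ → ℝ} (hf : Measurable f) (hf0 : ∀ t, 0 ≤ f t)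
    {M B s : ℝ} (hs : 0 < s) (hB : 0 ≤ B) (hM : ∀ t, f t ≤ M)
    (hint : ∀ a b : ℝ, a ≤ b → (∫ t in Icc a b, f t) ≤ B * (b - a) ^ s)
    {a b p q : ℝ} (hab : a ≤ b) (hp : p ∈ Icc (1 : ℝ) 2) :
    ∫⁻ z in Icc a b, ENNReal.ofReal (f ((z - q) / p)) ≤
      ENNReal.ofReal (2 * (B * (b - a) ^ s)) := by
  have hp0 : 0 < p := by linarith [hp.1]
  have hI : IntegrableOn (fun z => f ((z - q) / p)) (Icc a b) := by
    refine Measure.integrableOn_of_bounded (M := M) (by simp)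
      (hf.comp (by fun_prop)).aestronglyMeasurable ?_
    refine Filter.Eventually.of_forall fun z => ?_
    rw [Real.norm_of_nonneg (hf0 _)]
    exact hM _
  rw [← ofReal_integral_eq_lintegral_ofReal hI (Filter.Eventually.of_forall fun z => hf0 _)]
  refine ENNReal.ofReal_le_ofReal ?_
  have hab' : a / p - q / p ≤ b / p - q / p := by gcongr
  rw [integral_Icc_eq_integral_Ioc, ← intervalIntegral.integral_of_le hab]
  simp only [sub_div]
  rw [intervalIntegral.integral_comp_div_sub _ hp0.ne', smul_eq_mul,
    intervalIntegral.integral_of_le hab', ← integral_Icc_eq_integral_Ioc]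
  have hlen : (b / p - q / p) - (a / p - q / p) = (b - a) / p := by ring
  have h := hint _ _ hab'
  rw [hlen] at h
  have hnn : 0 ≤ b - a := sub_nonneg.2 hab
  have hle : ((b - a) / p) ^ s ≤ (b - a) ^ s :=
    Real.rpow_le_rpow (by positivity) (div_le_self hnn hp.1) hs.le
  calc _ ≤ p * (B * (b - a) ^ s) := by gcongr; exact h.trans (by gcongr)
    _ ≤ 2 * (B * (b - a) ^ s) := by gcongr; exact hp.2

lemma prod_le_pow_mul {d : ℕ} {f : ℝ → ℝ} (hf0 : ∀ t, 0 ≤ f t) {M : ℝ} (hM : ∀ t, f t ≤ M)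
    (y : Fin d → ℝ) (i : Fin d) : ∏ l, f (y l) ≤ M ^ (d - 1) * f (y i) := by
  rw [← Finset.prod_erase_mul _ _ (Finset.mem_univ i)]
  refine mul_le_mul_of_nonneg_right ?_ (hf0 _)
  refine (Finset.prod_le_prod (fun l _ => hf0 _) fun l _ => hM (y l)).trans ?_
  simp

theorem stmt12 (s : ℝ) (hs : s ∈ Ioo (0 : ℝ) 1) (d : ℕ) (hd : 2 ≤ d) :
    ∃ C : ℝ, 0 < C ∧
    ∀ B : ℝ, 1 ≤ B →
    ∀ m k : ℕ, 1 ≤ m → m ≤ k →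
    ∀ f : ℝ → ℝ, Measurable f → (∀ t, 0 ≤ f t) → (∀ t ∉ Icc (1 : ℝ) 2, f t = 0) →
      (∀ t, f t ≤ B * 2 ^ ((k : ℝ) * (1 - s))) →
      (∀ a b : ℝ, a ≤ b → (∫ t in Icc a b, f t) ≤ B * (b - a) ^ s) →
    ∀ x : Fin d → ℝ, (∀ i, x i ∈ Icc (-4 : ℝ) 0) →
      (∀ i j, i ≠ j → 4 * (2 : ℝ) ^ (-(m : ℤ)) < |x i - x j|) →
    ∀ r : Fin d → ℝ, (∀ i, r i ∈ Icc (1 : ℝ) 2) →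
      (∫ y in line d x r ∩ Metric.cthickening ((2 : ℝ) ^ (-(k : ℤ))) (diag d),
          ∏ i, f (y i) ∂μH[1]) ≤
        C * B ^ d * 2 ^ ((m : ℝ) * s + (k : ℝ) * ((d : ℝ) - 1 - (d : ℝ) * s)) := by
  have hd0 : 0 < d := by omega
  refine ⟨d * (d * d) * (2 * 48 ^ s), by positivity, ?_⟩
  intro B hB m k hm hmk f hf hf0 hfsupp hfM hint x hx hxsep r hr
  have hB0 : 0 ≤ B := by linarith
  set M : ℝ := B * 2 ^ ((k : ℝ) * (1 - s)) with hMdef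
  have hM0 : 0 ≤ M := by positivity
  set δ : ℝ := (2 : ℝ) ^ (-(k : ℤ)) with hδdef
  set η : ℝ := (2 : ℝ) ^ (-(m : ℤ)) with hηdef
  have hδ : 0 < δ := by positivity
  have hη : 0 < η := by positivity
  have hδη : δ ≤ η := zpow_le_zpow_right₀ (by norm_num) (by omega)
  set ℓ : ℝ := 24 * (δ / η) with hℓdef
  have hℓ : 0 < ℓ := by positivity
  set P : EuclideanSpace ℝ (Fin d) → ℝ := fun y => ∏ i, f (y i) with hPdef
  have hP0 : ∀ y, 0 ≤ P y := fun y => Finset.prod_nonneg fun i _ => hf0 _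
  have hP : Measurable P :=
    Finset.measurable_fun_prod _ fun i _ => hf.comp (by fun_prop)
  set Q : ℝ := M ^ (d - 1) * (2 * (B * (2 * ℓ) ^ s)) with hQdef
  have hQ0 : 0 ≤ Q := by positivity
  set φ := lineParam d x r with hφdef
  have hφm : Measurable φ :=
    (lipschitzWith_lineParam d x r fun i => (hr i).1).continuous.measurable
  have hG : Measurable fun z => ENNReal.ofReal (P (φ z)) := (hP.comp hφm).ennreal_ofReal
  have hcover : ∀ i j : Fin d, ∃ c : ℝ, ∀ z, i ≠ j → |φ z i - φ z j| ≤ 3 / 2 * δ →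
      φ z i ∈ Icc (1 : ℝ) 2 → z ∈ Icc (c - ℓ) (c + ℓ) := by
    intro i j
    by_cases h : ∃ w, i ≠ j ∧ |φ w i - φ w j| ≤ 3 / 2 * δ
    · obtain ⟨w, hij, hw⟩ := h
      refine ⟨w, fun z _ hz hz1 => ?_⟩
      have := abs_sub_le_of_near_diag hη hδη (hr i) (hr j) (hxsep i j hij) hz hz1 hw
      rw [abs_le] at this
      constructor <;> linarith
    · exact ⟨0, fun z hij hz _ => absurd ⟨z, hij, hz⟩ h⟩
  choose c hc using hcover
  have hpiece : ∀ i j : Fin d,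
      ∫⁻ z in Icc (c i j - ℓ) (c i j + ℓ), ENNReal.ofReal (P (φ z)) ≤ ENNReal.ofReal Q := by
    intro i j
    calc ∫⁻ z in Icc (c i j - ℓ) (c i j + ℓ), ENNReal.ofReal (P (φ z))
        ≤ ∫⁻ z in Icc (c i j - ℓ) (c i j + ℓ),
            ENNReal.ofReal (M ^ (d - 1)) * ENNReal.ofReal (f ((z - x i) / r i)) := by
          refine lintegral_mono fun z => ?_
          rw [← ENNReal.ofReal_mul (by positivity)]
          exact ENNReal.ofReal_le_ofReal (prod_le_pow_mul hf0 hfM _ i)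
      _ = ENNReal.ofReal (M ^ (d - 1)) *
            ∫⁻ z in Icc (c i j - ℓ) (c i j + ℓ), ENNReal.ofReal (f ((z - x i) / r i)) :=
          lintegral_const_mul' _ _ ENNReal.ofReal_ne_top
      _ ≤ ENNReal.ofReal (M ^ (d - 1)) * ENNReal.ofReal (2 * (B * (2 * ℓ) ^ s)) := by
          have := setLIntegral_comp_affine_le (q := x i) hf hf0 hs.1 hB0 hfM hint
            (by linarith : c i j - ℓ ≤ c i j + ℓ) (hr i)
          rw [show c i j + ℓ - (c i j - ℓ) = 2 * ℓ by ring] at this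
          gcongr
      _ = ENNReal.ofReal Q := by rw [← ENNReal.ofReal_mul (by positivity)]
  have hS : MeasurableSet (Metric.cthickening δ (diag d)) :=
    Metric.isClosed_cthickening.measurableSet
  have hparam : ∫⁻ z in φ ⁻¹' Metric.cthickening δ (diag d), ENNReal.ofReal (P (φ z)) ≤
      (d * d : ENNReal) * ENNReal.ofReal Q := by
    rw [← lintegral_indicator (hφm hS)]
    calc _ ≤ ∫⁻ z, ∑ i, ∑ j, (Icc (c i j - ℓ) (c i j + ℓ)).indicator
              (fun z => ENNReal.ofReal (P (φ z))) z := by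
          refine lintegral_mono fun z => indicator_apply_le' (fun hz => ?_) fun _ => zero_le
          obtain ⟨i, j, hij, hnear⟩ := exists_abs_sub_le_of_mem_cthickening_diag hδ hz
          by_cases hi : φ z i ∈ Icc (1 : ℝ) 2
          · have hz' := hc i j z hij hnear hi
            have h1 := Finset.single_le_sum (f := fun j' => (Icc (c i j' - ℓ) (c i j' + ℓ)).indicator
              (fun z => ENNReal.ofReal (P (φ z))) z) (fun _ _ => zero_le) (Finset.mem_univ j)
            have h2 := Finset.single_le_sum (f := fun i' => ∑ j',
              (Icc (c i' j' - ℓ) (c i' j' + ℓ)).indicator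
              (fun z => ENNReal.ofReal (P (φ z))) z) (fun _ _ => zero_le) (Finset.mem_univ i)
            simp only [indicator_of_mem hz'] at h1
            exact h1.trans h2
          · have : P (φ z) = 0 := Finset.prod_eq_zero (Finset.mem_univ i) (hfsupp _ hi)
            simp [this]
      _ = ∑ i, ∑ j, ∫⁻ z in Icc (c i j - ℓ) (c i j + ℓ), ENNReal.ofReal (P (φ z)) := by
          have hmeas : ∀ i j, Measurable ((Icc (c i j - ℓ) (c i j + ℓ)).indicator
              (fun z => ENNReal.ofReal (P (φ z)))) := fun i j => hG.indicator measurableSet_Icc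
          rw [lintegral_finsetSum _ fun i _ => Finset.measurable_fun_sum _ fun j _ => hmeas i j]
          refine Finset.sum_congr rfl fun i _ => ?_
          rw [lintegral_finsetSum _ fun j _ => hmeas i j]
          exact Finset.sum_congr rfl fun j _ => lintegral_indicator measurableSet_Icc _
      _ ≤ ∑ _i : Fin d, ∑ _j : Fin d, ENNReal.ofReal Q :=
          Finset.sum_le_sum fun i _ => Finset.sum_le_sum fun j _ => hpiece i j
      _ = (d * d : ENNReal) * ENNReal.ofReal Q := by simp [mul_assoc]
  have hmain : ∫⁻ y in line d x r ∩ Metric.cthickening δ (diag d), ENNReal.ofReal (P y) ∂μH[1] ≤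
      ENNReal.ofReal (d * (d * d) * Q) := by
    refine (setLIntegral_line_inter_le d x r (fun i => (hr i).1) hS hP.ennreal_ofReal).trans ?_
    refine (mul_le_mul_right hparam _).trans (le_of_eq ?_)
    rw [ENNReal.ofReal_mul (p := d * (d * d)) (by positivity), ← mul_assoc]
    congr 1
    exact_mod_cast (ENNReal.ofReal_natCast (d * (d * d))).symm
  rw [integral_eq_lintegral_of_nonneg_ae (Filter.Eventually.of_forall hP0)
    hP.aestronglyMeasurable]
  refine (ENNReal.toReal_le_of_le_ofReal (by positivity) hmain).trans (le_of_eq ?_)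
  have hδη' : δ / η = 2 ^ ((m : ℝ) - k) := by
    rw [hδdef, hηdef, ← zpow_sub₀ two_ne_zero, ← Real.rpow_intCast]
    congr 1
    push_cast
    ring
  have hlen : (2 * ℓ) ^ s = 48 ^ s * 2 ^ (((m : ℝ) - k) * s) := by
    rw [hℓdef, hδη', ← mul_assoc, Real.mul_rpow (by positivity) (by positivity),
      ← Real.rpow_mul zero_le_two]
    norm_num
  have hpow : M ^ (d - 1) = B ^ (d - 1) * 2 ^ ((k : ℝ) * (1 - s) * ((d : ℝ) - 1)) := by
    rw [hMdef, mul_pow, ← Real.rpow_natCast (2 ^ ((k : ℝ) * (1 - s))), ← Real.rpow_mul zero_le_two,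
      Nat.cast_sub hd0, Nat.cast_one]
  have hBd : B ^ d = B ^ (d - 1) * B := by rw [← pow_succ, Nat.sub_add_cancel hd0]
  have hexp : (2 : ℝ) ^ ((m : ℝ) * s + (k : ℝ) * ((d : ℝ) - 1 - (d : ℝ) * s)) =
      2 ^ ((k : ℝ) * (1 - s) * ((d : ℝ) - 1)) * 2 ^ (((m : ℝ) - k) * s) := by
    rw [← Real.rpow_add zero_lt_two]
    congr 1
    ring
  rw [hQdef, hlen, hpow, hBd, hexp]
  ring
end

section
/- There is a constant C < ∞ such that the following holds. Let m ≤ k be positive integers, let x_1, x_2 ∈ [−4,0] with |x_1 − x_2| > 4·2^{−m}, and let r_1, r_2 ∈ [1,2]. Then the set Δ_{1,2,k} = {z ∈ [−3,4] : |(z−x_1)/r_1 − (z−x_2)/r_2| < 2^{−k}} has Lebesgue measure at most C·2^{m−k}; moreover, if |r_1 − r_2| < 2^{−m}/16 then Δ_{1,2,k} is empty. -/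
open MeasureTheory Set

/-- Clearing denominators in the difference of two affine maps. -/
lemma abs_affine_lt_of_abs_div_sub_div_lt {x₁ x₂ r₁ r₂ z b : ℝ} (h₁ : 0 < r₁) (h₂ : 0 < r₂)
    (h : |(z - x₁) / r₁ - (z - x₂) / r₂| < b) :
    |z * (r₂ - r₁) + (x₂ * r₁ - x₁ * r₂)| < r₁ * r₂ * b := by
  have e : z * (r₂ - r₁) + (x₂ * r₁ - x₁ * r₂) =
      r₁ * r₂ * ((z - x₁) / r₁ - (z - x₂) / r₂) := by
    field_simp
    ring
  rw [e, abs_mul, abs_of_pos (mul_pos h₁ h₂)]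
  exact mul_lt_mul_of_pos_left h (mul_pos h₁ h₂)

/-- Two centres that are far apart force the radii apart. -/
lemma le_abs_sub_of_abs_div_sub_div_lt {x₁ x₂ r₁ r₂ z a b : ℝ} (hba : b ≤ a) (ha : 0 < a)
    (hx₁ : x₁ ∈ Icc (-4 : ℝ) 0) (hx : 4 * a < |x₁ - x₂|)
    (hr₁ : r₁ ∈ Icc (1 : ℝ) 2) (hr₂ : r₂ ∈ Icc (1 : ℝ) 2) (hz : z ∈ Icc (-3 : ℝ) 4)
    (h : |(z - x₁) / r₁ - (z - x₂) / r₂| < b) : a / 16 ≤ |r₁ - r₂| := by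
  obtain ⟨h1, h1'⟩ := hr₁
  obtain ⟨h2, h2'⟩ := hr₂
  have key := abs_affine_lt_of_abs_div_sub_div_lt (by linarith) (by linarith) h
  have hzx : |z - x₁| ≤ 8 := by
    rw [abs_le]
    constructor <;> linarith [hz.1, hz.2, hx₁.1, hx₁.2]
  have e : (x₁ - x₂) * r₁ =
      -(z * (r₂ - r₁) + (x₂ * r₁ - x₁ * r₂)) - (z - x₁) * (r₁ - r₂) := by ring
  have tri : |x₁ - x₂| * r₁ ≤
      |z * (r₂ - r₁) + (x₂ * r₁ - x₁ * r₂)| + |z - x₁| * |r₁ - r₂| := by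
    rw [← abs_of_pos (show 0 < r₁ by linarith), ← abs_mul, abs_of_pos (show 0 < r₁ by linarith),
      e, ← abs_mul, ← abs_neg (z * (r₂ - r₁) + _)]
    exact abs_sub _ _
  have hp : |z - x₁| * |r₁ - r₂| ≤ 8 * |r₁ - r₂| := by gcongr
  have hb : r₁ * r₂ * b ≤ r₁ * (2 * a) := by
    rw [mul_assoc]
    have hrb : r₂ * b ≤ r₂ * a := by gcongr
    have hra : r₂ * a ≤ 2 * a := by gcongr
    exact mul_le_mul_of_nonneg_left (hrb.trans hra) (by linarith)
  have hl : 4 * a * r₁ < |x₁ - x₂| * r₁ := by gcongr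
  have : a ≤ a * r₁ := le_mul_of_one_le_right ha.le h1
  linarith

lemma volume_setOf_abs_mul_add_lt_le {d e ε : ℝ} (hd : d ≠ 0) :
    volume {z : ℝ | |z * d + e| < ε} ≤ ENNReal.ofReal (2 * (ε / |d|)) := by
  have hsub : {z : ℝ | |z * d + e| < ε} ⊆ Metric.ball (-e / d) (ε / |d|) := by
    intro z hz
    have he : (z - -e / d) * d = z * d + e := by
      field_simp
      ring
    rw [Metric.mem_ball, Real.dist_eq, lt_div_iff₀ (abs_pos.2 hd), ← abs_mul, he]
    exact hz
  exact (measure_mono hsub).trans (Real.volume_ball _ _).le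

theorem stmt13 :
    ∃ C : ℝ, 0 < C ∧
    ∀ m k : ℕ, 1 ≤ m → m ≤ k →
    ∀ x₁ x₂ : ℝ, x₁ ∈ Icc (-4 : ℝ) 0 → x₂ ∈ Icc (-4 : ℝ) 0 →
      4 * (2 : ℝ) ^ (-(m : ℤ)) < |x₁ - x₂| →
    ∀ r₁ r₂ : ℝ, r₁ ∈ Icc (1 : ℝ) 2 → r₂ ∈ Icc (1 : ℝ) 2 →
      volume {z : ℝ | z ∈ Icc (-3 : ℝ) 4 ∧
          |(z - x₁) / r₁ - (z - x₂) / r₂| < (2 : ℝ) ^ (-(k : ℤ))} ≤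
        ENNReal.ofReal (C * (2 : ℝ) ^ ((m : ℤ) - (k : ℤ))) ∧
      (|r₁ - r₂| < (2 : ℝ) ^ (-(m : ℤ)) / 16 →
        {z : ℝ | z ∈ Icc (-3 : ℝ) 4 ∧
          |(z - x₁) / r₁ - (z - x₂) / r₂| < (2 : ℝ) ^ (-(k : ℤ))} = ∅) := by
  refine ⟨128, by norm_num, ?_⟩
  intro m k _ hmk x₁ x₂ hx₁ _ hx r₁ r₂ hr₁ hr₂
  have hba : (2 : ℝ) ^ (-(k : ℤ)) ≤ (2 : ℝ) ^ (-(m : ℤ)) :=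
    zpow_le_zpow_right₀ (by norm_num) (by omega)
  have ha : (0 : ℝ) < (2 : ℝ) ^ (-(m : ℤ)) := by positivity
  have hb : (0 : ℝ) < (2 : ℝ) ^ (-(k : ℤ)) := by positivity
  have hmk' : (2 : ℝ) ^ ((m : ℤ) - (k : ℤ)) = (2 : ℝ) ^ (-(k : ℤ)) / (2 : ℝ) ^ (-(m : ℤ)) := by
    rw [← zpow_sub₀ (by norm_num)]
    congr 1
    ring
  rw [hmk']
  generalize (2 : ℝ) ^ (-(m : ℤ)) = a at *
  generalize (2 : ℝ) ^ (-(k : ℤ)) = b at *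
  have hempty : |r₁ - r₂| < a / 16 →
      {z : ℝ | z ∈ Icc (-3 : ℝ) 4 ∧ |(z - x₁) / r₁ - (z - x₂) / r₂| < b} = ∅ := by
    intro hr
    rw [eq_empty_iff_forall_notMem]
    rintro z ⟨hz, h⟩
    exact hr.not_ge (le_abs_sub_of_abs_div_sub_div_lt hba ha hx₁ hx hr₁ hr₂ hz h)
  refine ⟨?_, hempty⟩
  rcases lt_or_ge |r₁ - r₂| (a / 16) with hr | hr
  · rw [hempty hr, measure_empty]
    exact zero_le
  · rw [abs_sub_comm] at hr
    have hd : 0 < |r₂ - r₁| := by linarith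
    have hsub : {z : ℝ | z ∈ Icc (-3 : ℝ) 4 ∧ |(z - x₁) / r₁ - (z - x₂) / r₂| < b} ⊆
        {z : ℝ | |z * (r₂ - r₁) + (x₂ * r₁ - x₁ * r₂)| < 4 * b} := by
      rintro z ⟨_, h⟩
      refine (abs_affine_lt_of_abs_div_sub_div_lt (by linarith [hr₁.1]) (by linarith [hr₂.1])
        h).trans_le ?_
      gcongr
      nlinarith [hr₁.1, hr₁.2, hr₂.1, hr₂.2]
    refine (measure_mono hsub).trans
      ((volume_setOf_abs_mul_add_lt_le (abs_pos.1 hd)).trans (ENNReal.ofReal_le_ofReal ?_))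
    calc 2 * (4 * b / |r₂ - r₁|) ≤ 2 * (4 * b / (a / 16)) := by gcongr
      _ = 128 * (b / a) := by
        field_simp
        norm_num
end

section
/- For every integer d ≥ 1 there is a constant C = C(d) such that for every integer k ≥ 0 and every cube Q ∈ 𝒬_k with Q ⊂ [0,3]^d, the map (x,r) ↦ ℋ¹(Q ∩ L_{x,r}) is C-Lipschitz on [−4,0]^d × [1,2]^d (with respect to the Euclidean metric); the Lipschitz constant C is independent of Q and of k. -/
open MeasureTheory Set

/-- The dyadic cube of generation `k` indexed by `q : Fin d → ℤ`. -/
def dyadicCube (d k : ℕ) (q : Fin d → ℤ) : Set (EuclideanSpace ℝ (Fin d)) :=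
  {y | ∀ i, y i ∈ Icc ((q i : ℝ) / 2 ^ k) (((q i : ℝ) + 1) / 2 ^ k)}

/-- The direction vector `(1/r_1, …, 1/r_d)` of the line `L_{x,r}`. -/
noncomputable def lineDir (d : ℕ) (r : Fin d → ℝ) : EuclideanSpace ℝ (Fin d) :=
  WithLp.toLp 2 fun i => (r i)⁻¹

theorem abs_ciSup_sub_ciSup_le {ι : Type*} [Finite ι] [Nonempty ι] {f g : ι → ℝ} {D : ℝ}
    (h : ∀ i, |f i - g i| ≤ D) : |(⨆ i, f i) - ⨆ i, g i| ≤ D := by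
  rw [abs_sub_le_iff]
  constructor
  · rw [sub_le_iff_le_add]
    refine ciSup_le fun i => ?_
    have h1 := (abs_sub_le_iff.1 (h i)).1
    have h2 := le_ciSup (Finite.bddAbove_range g) i
    linarith
  · rw [sub_le_iff_le_add]
    refine ciSup_le fun i => ?_
    have h1 := (abs_sub_le_iff.1 (h i)).2
    have h2 := le_ciSup (Finite.bddAbove_range f) i
    linarith

theorem abs_ciInf_sub_ciInf_le {ι : Type*} [Finite ι] [Nonempty ι] {f g : ι → ℝ} {D : ℝ}
    (h : ∀ i, |f i - g i| ≤ D) : |(⨅ i, f i) - ⨅ i, g i| ≤ D := by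
  rw [abs_sub_le_iff]
  constructor
  · rw [sub_le_comm]
    refine le_ciInf fun i => ?_
    have h1 := (abs_sub_le_iff.1 (h i)).1
    have h2 := ciInf_le (Finite.bddBelow_range f) i
    linarith
  · rw [sub_le_comm]
    refine le_ciInf fun i => ?_
    have h1 := (abs_sub_le_iff.1 (h i)).2
    have h2 := ciInf_le (Finite.bddBelow_range g) i
    linarith

/-- The part of `L_{x,r}` in a box is an affine copy of an interval. -/
theorem hausdorffMeasure_box_inter_line {d : ℕ} [Nonempty (Fin d)] (a b x r : Fin d → ℝ)
    (hr : ∀ i, 0 < r i) :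
    (μH[1] ({y : EuclideanSpace ℝ (Fin d) | ∀ i, y i ∈ Icc (a i) (b i)} ∩ line d x r)).toReal =
      ‖lineDir d r‖ * max ((⨅ i, (x i + r i * b i)) - ⨆ i, (x i + r i * a i)) 0 := by
  set p : EuclideanSpace ℝ (Fin d) := WithLp.toLp 2 fun i => -x i / r i with hp
  have himage : {y : EuclideanSpace ℝ (Fin d) | ∀ i, y i ∈ Icc (a i) (b i)} ∩ line d x r =
      (fun y => p + y) '' ((fun z : ℝ => z • lineDir d r) ''
        Icc (⨆ i, (x i + r i * a i)) (⨅ i, (x i + r i * b i))) := by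
    rw [image_image]
    have hcoord : ∀ (z : ℝ) (i : Fin d), (p + z • lineDir d r) i = (z - x i) / r i := by
      intro z i
      simp only [hp, lineDir, PiLp.add_apply, PiLp.smul_apply, smul_eq_mul]
      ring
    ext y
    constructor
    · rintro ⟨hy, z, hz⟩
      refine ⟨z, ⟨ciSup_le fun i => ?_, le_ciInf fun i => ?_⟩, ?_⟩
      · have h := (hy i).1
        rw [hz i, le_div_iff₀ (hr i)] at h
        linarith
      · have h := (hy i).2
        rw [hz i, div_le_iff₀ (hr i)] at h
        linarith
      · ext i
        rw [hz i]
        exact hcoord z i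
    · rintro ⟨z, ⟨h1, h2⟩, rfl⟩
      refine ⟨fun i => ?_, z, hcoord z⟩
      have h3 := (le_ciSup (Finite.bddAbove_range fun i => x i + r i * a i) i).trans h1
      have h4 := h2.trans (ciInf_le (Finite.bddBelow_range fun i => x i + r i * b i) i)
      simp only at h3 h4 ⊢
      rw [hcoord, mem_Icc, le_div_iff₀ (hr i), div_le_iff₀ (hr i)]
      constructor <;> linarith
  rw [himage, (isometry_add_left p).hausdorffMeasure_image (Or.inl zero_le_one),
    hausdorffMeasure_smul_right_image, hausdorffMeasure_real, Real.volume_Icc,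
    ENNReal.smul_def, smul_eq_mul, ENNReal.toReal_mul, ENNReal.toReal_ofReal']
  simp

theorem norm_lineDir_sub_le {d : ℕ} (r r' : EuclideanSpace ℝ (Fin d))
    (hr : ∀ i, 1 ≤ r i) (hr' : ∀ i, 1 ≤ r' i) :
    ‖lineDir d r - lineDir d r'‖ ≤ dist r r' := by
  rw [EuclideanSpace.norm_eq, EuclideanSpace.dist_eq]
  refine Real.sqrt_le_sqrt (Finset.sum_le_sum fun i _ => ?_)
  have h : (lineDir d r - lineDir d r') i = (r' i - r i) / (r i * r' i) := by
    have h1 := hr i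
    have h2 := hr' i
    simp only [lineDir, PiLp.sub_apply]
    field_simp
  rw [h, Real.norm_eq_abs, abs_div, Real.dist_eq, abs_sub_comm (r i)]
  have h1 : 1 ≤ |r i * r' i| :=
    (one_le_mul_of_one_le_of_one_le (hr i) (hr' i)).trans (le_abs_self _)
  gcongr
  exact div_le_self (abs_nonneg _) h1

theorem norm_lineDir_le {d : ℕ} (r : Fin d → ℝ) (hr : ∀ i, 1 ≤ r i) :
    ‖lineDir d r‖ ≤ √d := by
  rw [EuclideanSpace.norm_eq]
  refine Real.sqrt_le_sqrt ?_
  calc ∑ i, ‖lineDir d r i‖ ^ 2 ≤ ∑ _i : Fin d, (1 : ℝ) := by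
        refine Finset.sum_le_sum fun i _ => ?_
        have h1 : (0 : ℝ) < r i := one_pos.trans_le (hr i)
        have h2 : ‖lineDir d r i‖ ≤ 1 := by
          simp only [lineDir]
          rw [Real.norm_of_nonneg (inv_nonneg.2 h1.le)]
          exact inv_le_one_of_one_le₀ (hr i)
        exact pow_le_one₀ (norm_nonneg _) h2
    _ = d := by simp

theorem abs_sub_apply_le_dist {d : ℕ} (x y : EuclideanSpace ℝ (Fin d)) (i : Fin d) :
    |x i - y i| ≤ dist x y := by
  rw [dist_eq_norm]
  exact PiLp.norm_apply_le (x - y) i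

theorem abs_affine_sub_affine_le {d : ℕ} (x x' r r' : EuclideanSpace ℝ (Fin d)) {c : Fin d → ℝ}
    (hc : ∀ i, c i ∈ Icc (0 : ℝ) 3) (i : Fin d) :
    |(x i + r i * c i) - (x' i + r' i * c i)| ≤ dist x x' + 3 * dist r r' := by
  have h1 := abs_sub_apply_le_dist x x' i
  have h2 := abs_sub_apply_le_dist r r' i
  obtain ⟨h3, h4⟩ := hc i
  calc |(x i + r i * c i) - (x' i + r' i * c i)|
      = |(x i - x' i) + c i * (r i - r' i)| := by ring_nf
    _ ≤ |x i - x' i| + c i * |r i - r' i| := by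
        refine (abs_add_le _ _).trans ?_
        rw [abs_mul, abs_of_nonneg h3]
    _ ≤ dist x x' + 3 * dist r r' := by gcongr

theorem stmt16 (d : ℕ) (hd : 1 ≤ d) :
    ∃ C : ℝ, 0 < C ∧
    ∀ (k : ℕ) (q : Fin d → ℤ),
      dyadicCube d k q ⊆ {y | ∀ i, y i ∈ Icc (0 : ℝ) 3} →
    ∀ x x' r r' : EuclideanSpace ℝ (Fin d),
      (∀ i, x i ∈ Icc (-4 : ℝ) 0) → (∀ i, x' i ∈ Icc (-4 : ℝ) 0) →
      (∀ i, r i ∈ Icc (1 : ℝ) 2) → (∀ i, r' i ∈ Icc (1 : ℝ) 2) →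
      |(μH[1] (dyadicCube d k q ∩ line d x r)).toReal -
          (μH[1] (dyadicCube d k q ∩ line d x' r')).toReal| ≤
        C * (dist x x' + dist r r') := by
  have : Nonempty (Fin d) := ⟨⟨0, hd⟩⟩
  refine ⟨6 * √d + 6, by positivity, ?_⟩
  intro k q hQ x x' r r' _ _ hr hr'
  set a : Fin d → ℝ := fun i => (q i : ℝ) / 2 ^ k with ha
  set b : Fin d → ℝ := fun i => ((q i : ℝ) + 1) / 2 ^ k with hb
  have hab : ∀ i, a i ≤ b i := fun i => by
    simp only [ha, hb]
    gcongr
    linarith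
  have ha3 : ∀ i, a i ∈ Icc (0 : ℝ) 3 :=
    @hQ (WithLp.toLp 2 a) fun i => ⟨le_rfl, hab i⟩
  have hb3 : ∀ i, b i ∈ Icc (0 : ℝ) 3 :=
    @hQ (WithLp.toLp 2 b) fun i => ⟨hab i, le_rfl⟩
  have hmeas : ∀ x r : EuclideanSpace ℝ (Fin d), (∀ i, r i ∈ Icc (1 : ℝ) 2) →
      (μH[1] (dyadicCube d k q ∩ line d x r)).toReal =
      ‖lineDir d r‖ * max ((⨅ i, (x i + r i * b i)) - ⨆ i, (x i + r i * a i)) 0 :=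
    fun x r hr => hausdorffMeasure_box_inter_line a b x r fun i => one_pos.trans_le (hr i).1
  rw [hmeas x r hr, hmeas x' r' hr']
  have hinf := abs_ciInf_sub_ciInf_le (abs_affine_sub_affine_le x x' r r' hb3)
  have hsup := abs_ciSup_sub_ciSup_le (abs_affine_sub_affine_le x x' r r' ha3)
  have hlen : (⨅ i, (x' i + r' i * b i)) - ⨆ i, (x' i + r' i * a i) ≤ 6 := by
    let i : Fin d := ⟨0, hd⟩
    have h1 := ciInf_le (Finite.bddBelow_range fun i => x' i + r' i * b i) i
    have h2 := le_ciSup (Finite.bddAbove_range fun i => x' i + r' i * a i) i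
    simp only at h1 h2
    have h3 : r' i * b i ≤ 2 * 3 :=
      mul_le_mul (hr' i).2 (hb3 i).2 (hb3 i).1 zero_le_two
    have h4 : 0 ≤ r' i * a i := mul_nonneg (zero_le_one.trans (hr' i).1) (ha3 i).1
    linarith
  have hdir : |‖lineDir d r‖ - ‖lineDir d r'‖| ≤ dist r r' :=
    (abs_norm_sub_norm_le _ _).trans
      (norm_lineDir_sub_le r r' (fun i => (hr i).1) fun i => (hr' i).1)
  have hdir_le := norm_lineDir_le r fun i => (hr i).1
  generalize (⨅ i, (x i + r i * b i)) = u at *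
  generalize (⨆ i, (x i + r i * a i)) = v at *
  generalize (⨅ i, (x' i + r' i * b i)) = u' at *
  generalize (⨆ i, (x' i + r' i * a i)) = v' at *
  have hmax : |max (u - v) 0 - max (u' - v') 0| ≤ 2 * dist x x' + 6 * dist r r' := by
    refine (abs_max_sub_max_le_abs _ _ _).trans ?_
    rw [sub_sub_sub_comm]
    refine (abs_sub _ _).trans ?_
    linarith
  have hmax_nonneg : 0 ≤ max (u' - v') 0 := le_max_right _ _
  have hmax_le : max (u' - v') 0 ≤ 6 := max_le hlen (by norm_num)
  have hx : 0 ≤ dist x x' := dist_nonneg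
  calc |‖lineDir d r‖ * max (u - v) 0 - ‖lineDir d r'‖ * max (u' - v') 0|
      = |‖lineDir d r‖ * (max (u - v) 0 - max (u' - v') 0) +
          max (u' - v') 0 * (‖lineDir d r‖ - ‖lineDir d r'‖)| := by ring_nf
    _ ≤ ‖lineDir d r‖ * |max (u - v) 0 - max (u' - v') 0| +
          max (u' - v') 0 * |‖lineDir d r‖ - ‖lineDir d r'‖| := by
        refine (abs_add_le _ _).trans ?_
        rw [abs_mul, abs_mul, abs_of_nonneg hmax_nonneg, abs_norm]
    _ ≤ √d * (2 * dist x x' + 6 * dist r r') + 6 * dist r r' := by gcongr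
    _ ≤ (6 * √d + 6) * (dist x x' + dist r r') := by
        have : 0 ≤ √d * dist x x' := by positivity
        linarith
end
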